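/- arXiv:1107.4906 — 3 statements merged into one kernel-verified Lean document; each statement's English description precedes it below -/
import Mathlib

section
/- For 4 general points of P^1 x P^1, the ideal I of the points satisfies γ(I) = 8/3; that is, there is a nonempty Zariski-open subset U of (P^1 x P^1)^4 such that for every 4-tuple of pairwise distinct points lying in U, with I the ideal of these points, α(I^(m))/m tends to 8/3 as m → ∞. -/
open MvPolynomial

noncomputable section

/-- The weights giving the bigrading on `k[x0,x1,y0,y1]` with
`deg x0 = deg x1 = (1,0)` and `deg y0 = deg y1 = (0,1)`. -/
def w4 : Fin 4 → ℕ × ℕ := ![(1,0), (1,0), (0,1), (0,1)]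

variable (k : Type*) [Field k]

/-- `p = ((a0,a1),(b0,b1))` represents a point `[a0:a1] × [b0:b1]` of `P^1 × P^1`
if neither pair of coordinates is identically zero. -/
def IsPtRep (p : (k × k) × (k × k)) : Prop := p.1 ≠ 0 ∧ p.2 ≠ 0

/-- Two (nonzero) vectors of `k²` define the same point of `P^1`. -/
def ProjEq (u v : k × k) : Prop := u.1 * v.2 = u.2 * v.1

/-- Two representatives define the same point of `P^1 × P^1`. -/
def PtEq (p q : (k × k) × (k × k)) : Prop := ProjEq k p.1 q.1 ∧ ProjEq k p.2 q.2

/-- The bihomogeneous ideal of the point `[a0:a1] × [b0:b1]`, namely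
`(a1*x0 - a0*x1, b1*y0 - b0*y1)`. -/
def pointIdeal (p : (k × k) × (k × k)) : Ideal (MvPolynomial (Fin 4) k) :=
  Ideal.span {C p.1.2 * X 0 - C p.1.1 * X 1, C p.2.2 * X 2 - C p.2.1 * X 3}

/-- The ideal `I(Z) = ∩ I(P_i)` of a finite tuple of points. -/
def idealOfPoints {s : ℕ} (Z : Fin s → (k × k) × (k × k)) :
    Ideal (MvPolynomial (Fin 4) k) :=
  ⨅ i, pointIdeal k (Z i)

/-- The `m`-th symbolic power `I(Z)^(m) = ∩ I(P_i)^m`. -/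
def symbolicPower {s : ℕ} (Z : Fin s → (k × k) × (k × k)) (m : ℕ) :
    Ideal (MvPolynomial (Fin 4) k) :=
  ⨅ i, (pointIdeal k (Z i)) ^ m

/-- The bigraded piece `J_(i,j)` of a bihomogeneous ideal, as a `k`-subspace. -/
def bipiece (J : Ideal (MvPolynomial (Fin 4) k)) (d : ℕ × ℕ) :
    Submodule k (MvPolynomial (Fin 4) k) :=
  (Submodule.restrictScalars k J) ⊓ (weightedHomogeneousSubmodule k w4 d)

/-- `α(J)`: the least total degree `t = i + j` in which `J` has a nonzero
bihomogeneous element of bidegree `(i,j)`. -/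
def alpha (J : Ideal (MvPolynomial (Fin 4) k)) : ℕ :=
  sInf {t | ∃ F ∈ J, F ≠ 0 ∧ ∃ d : ℕ × ℕ, d.1 + d.2 = t ∧ F.IsWeightedHomogeneous w4 d}

/-- The coordinates of a tuple of points of `P^1 × P^1`, as a point of affine `4s`-space. -/
def coordsOf {s : ℕ} (Z : Fin s → (k × k) × (k × k)) : Fin s × Fin 4 → k :=
  fun p => ![(Z p.1).1.1, (Z p.1).1.2, (Z p.1).2.1, (Z p.1).2.2] p.2

/-- The weights making `k[(P^1 × P^1)^s]` multigraded. -/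
def wProd (s : ℕ) : Fin s × Fin 4 → (Fin s → ℕ × ℕ) := fun p => Pi.single p.1 (w4 p.2)

/-- `GeneralPosition k s P` says that property `P` holds for `s` general points of
`P^1 × P^1`: there is a nonempty Zariski-open subset `U` of `(P^1 × P^1)^s` (the
complement of the zero locus of a multihomogeneous form `G` not vanishing identically)
such that `P` holds for every tuple of pairwise distinct points lying in `U`. -/
def GeneralPosition (s : ℕ) (P : (Fin s → (k × k) × (k × k)) → Prop) : Prop :=
  ∃ (G : MvPolynomial (Fin s × Fin 4) k) (d : Fin s → ℕ × ℕ),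
    G.IsWeightedHomogeneous (wProd s) d ∧
    (∃ Z : Fin s → (k × k) × (k × k), (∀ i, IsPtRep k (Z i)) ∧ eval (coordsOf k Z) G ≠ 0) ∧
    ∀ Z : Fin s → (k × k) × (k × k), (∀ i, IsPtRep k (Z i)) →
      (∀ i j, i ≠ j → ¬ PtEq k (Z i) (Z j)) →
      eval (coordsOf k Z) G ≠ 0 → P Z

/-- Distinct points in multiplicity 1 generic position: every subset `S` imposes
independent conditions in every bidegree, i.e.
`dim_k I(S)_(i,j) = max {0, (i+1)(j+1) - |S|}`. -/
def Mult1Generic {s : ℕ} (Z : Fin s → (k × k) × (k × k)) : Prop :=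
  (∀ i, IsPtRep k (Z i)) ∧ (∀ i j, i ≠ j → ¬ PtEq k (Z i) (Z j)) ∧
  ∀ (S : Finset (Fin s)) (i j : ℕ),
    Module.finrank k ↥(bipiece k (⨅ a ∈ S, pointIdeal k (Z a)) (i, j))
      = (i + 1) * (j + 1) - S.card

lemma wh_deg {K : Type*} [Field K] {F : MvPolynomial (Fin 4) K} {p q : ℕ}
    (hF : F.IsWeightedHomogeneous w4 (p, q)) {e : Fin 4 →₀ ℕ} (he : e ∈ F.support) :
    e 0 + e 1 = p ∧ e 2 + e 3 = q := by
  have h := hF (mem_support_iff.1 he)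
  rw [Finsupp.weight_apply, Finsupp.sum_fintype _ _ (by simp)] at h
  simpa [Fin.sum_univ_four, w4, Prod.ext_iff] using h

lemma eval_scale {K : Type*} [Field K] {F : MvPolynomial (Fin 4) K} {p q : ℕ}
    (hF : F.IsWeightedHomogeneous w4 (p, q)) (c x0 x1 y0 y1 : K) :
    eval ![c * x0, c * x1, y0, y1] F = c ^ p * eval ![x0, x1, y0, y1] F := by
  rw [eval_eq', eval_eq', Finset.mul_sum]
  refine Finset.sum_congr rfl fun e he => ?_
  obtain ⟨h1, -⟩ := wh_deg hF he
  simp only [Fin.prod_univ_four, ← h1]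
  simp [mul_pow, pow_add]
  ring

lemma natDegree_restrict {K : Type*} [Field K] {F : MvPolynomial (Fin 4) K} {p q : ℕ}
    (hF : F.IsWeightedHomogeneous w4 (p, q)) (u v : Polynomial K)
    (hu : u.natDegree ≤ 2) (hv : v.natDegree ≤ 2) :
    (aeval ![1, Polynomial.X, u, v] F).natDegree ≤ p + 2 * q := by
  rw [aeval_def, eval₂_eq']
  refine Polynomial.natDegree_sum_le_of_forall_le _ _ fun e he => ?_
  obtain ⟨h1, h2⟩ := wh_deg hF he
  simp only [Fin.prod_univ_four, Polynomial.algebraMap_apply]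
  have e1 : (u ^ e 2).natDegree ≤ e 2 * 2 := Polynomial.natDegree_pow_le_of_le _ hu
  have e2 : (v ^ e 3).natDegree ≤ e 3 * 2 := Polynomial.natDegree_pow_le_of_le _ hv
  have e3 : ((Polynomial.X : Polynomial K) ^ e 1).natDegree ≤ e 1 := by simp
  refine (Polynomial.natDegree_C_mul_le _ _).trans ?_
  simp only [Matrix.cons_val_zero, Matrix.cons_val_one, Matrix.cons_val, one_pow, one_mul]
  refine (Polynomial.natDegree_mul_le_of_le (Polynomial.natDegree_mul_le_of_le e3 e1) e2).trans ?_
  omega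

/-- product of the linear factors at all nodes but the `j`-th -/
def ell {K : Type*} [Field K] (α : Fin 4 → K) (j : Fin 4) : Polynomial K :=
  ∏ i ∈ Finset.univ.erase j, (Polynomial.X - Polynomial.C (α i))

lemma ell_deg {K : Type*} [Field K] (α : Fin 4 → K) (j : Fin 4) :
    (ell α j - Polynomial.X ^ 3).natDegree ≤ 2 := by
  have key : ∀ a b c : K, ((Polynomial.X - Polynomial.C a) * (Polynomial.X - Polynomial.C b) *
      (Polynomial.X - Polynomial.C c) - Polynomial.X ^ 3).natDegree ≤ 2 := by
    intro a b c
    have : ((Polynomial.X - Polynomial.C a) * (Polynomial.X - Polynomial.C b) *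
      (Polynomial.X - Polynomial.C c) - Polynomial.X ^ 3) =
      Polynomial.C (-(a+b+c)) * Polynomial.X ^ 2 + Polynomial.C (a*b+b*c+a*c) * Polynomial.X
        + Polynomial.C (-(a*b*c)) := by
      simp only [map_neg, map_add, map_mul]; ring
    rw [this]
    exact Polynomial.natDegree_quadratic_le
  have h : ∃ a b c : Fin 4, Finset.univ.erase j = {a, b, c} ∧ a ≠ b ∧ a ≠ c ∧ b ≠ c := by
    revert j; decide
  obtain ⟨a, b, c, h, h1, h2, h3⟩ := h
  rw [ell, h, Finset.prod_insert (by simp [h1, h2]), Finset.prod_insert (by simp [h3]),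
    Finset.prod_singleton, ← mul_assoc]
  exact key _ _ _

lemma ell_sum_deg {K : Type*} [Field K] (α c : Fin 4 → K) (hc : ∑ i, c i = 0) :
    (∑ i, Polynomial.C (c i) * ell α i).natDegree ≤ 2 := by
  have : ∑ i, Polynomial.C (c i) * ell α i
      = ∑ i, Polynomial.C (c i) * (ell α i - Polynomial.X ^ 3) := by
    simp only [mul_sub, Finset.sum_sub_distrib, ← Finset.sum_mul, ← map_sum, hc]
    simp
  rw [this]
  exact Polynomial.natDegree_sum_le_of_forall_le _ _ fun i _ =>
    (Polynomial.natDegree_C_mul_le _ _).trans (ell_deg α i)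

lemma ell_eval_ne {K : Type*} [Field K] (α : Fin 4 → K) {i j : Fin 4} (h : i ≠ j) :
    (ell α j).eval (α i) = 0 := by
  rw [ell, Polynomial.eval_prod]
  exact Finset.prod_eq_zero (i := i) (by simp [h]) (by simp)

lemma ell_eval_mul {K : Type*} [Field K] (α : Fin 4 → K) (x : K) (j : Fin 4) :
    (x - α j) * (ell α j).eval x = ∏ i, (x - α i) := by
  rw [ell, Polynomial.eval_prod, ← Finset.mul_prod_erase _ _ (Finset.mem_univ j)]
  simp

/-- The four points impose independent conditions on forms of bidegree `(1,1)`. -/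
def Solv {K : Type*} [Field K] (Z : Fin 4 → (K × K) × (K × K)) : Prop :=
  ∀ y0 y1 y2 y3 : K, ∃ v : Fin 4 → K,
    ∑ i, v i * ((Z i).1.1 * (Z i).2.1) = y0 ∧ ∑ i, v i * ((Z i).1.1 * (Z i).2.2) = y1 ∧
    ∑ i, v i * ((Z i).1.2 * (Z i).2.1) = y2 ∧ ∑ i, v i * ((Z i).1.2 * (Z i).2.2) = y3

lemma exists_curve {K : Type*} [Field K] (Z : Fin 4 → (K × K) × (K × K))
    (ha : ∀ i, (Z i).1.1 ≠ 0) (hb : ∀ i, (Z i).2.1 ≠ 0) (hS : Solv Z) (x y0 y1 : K)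
    (hx : ∀ i, x - (Z i).1.2 / (Z i).1.1 ≠ 0) :
    ∃ u v : Polynomial K, u.natDegree ≤ 2 ∧ v.natDegree ≤ 2 ∧ u.eval x = y0 ∧ v.eval x = y1 ∧
      ∀ i, (Polynomial.X - Polynomial.C ((Z i).1.2 / (Z i).1.1)) ∣
        Polynomial.C (Z i).2.2 * u - Polynomial.C (Z i).2.1 * v := by
  set α : Fin 4 → K := fun i => (Z i).1.2 / (Z i).1.1 with hα
  set β : Fin 4 → K := fun i => (Z i).2.2 / (Z i).2.1 with hβ
  have hL : ∏ i, (x - α i) ≠ 0 := Finset.prod_ne_zero_iff.2 fun i _ => hx i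
  set L := ∏ i, (x - α i) with hLd
  obtain ⟨w, h0, h1, h2, h3⟩ := hS (y0 / L) (y1 / L) (x * (y0 / L)) (x * (y1 / L))
  set v : Fin 4 → K := fun i => w i * ((Z i).1.1 * (Z i).2.1) with hv
  have h1' : ∑ i, v i * β i = y1 / L := by
    rw [← h1]; refine Finset.sum_congr rfl fun i _ => ?_
    simp only [hv, hβ]; have := hb i; field_simp
  have h2' : ∑ i, v i * α i = x * (y0 / L) := by
    rw [← h2]; refine Finset.sum_congr rfl fun i _ => ?_
    simp only [hv, hα]; have := ha i; field_simp
  have h3' : ∑ i, v i * β i * α i = x * (y1 / L) := by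
    rw [← h3]; refine Finset.sum_congr rfl fun i _ => ?_
    simp only [hv, hα, hβ]; have := ha i; have := hb i; field_simp
  have h0' : ∑ i, v i = y0 / L := h0
  refine ⟨∑ i, Polynomial.C (v i * (x - α i)) * ell α i,
    ∑ i, Polynomial.C (v i * β i * (x - α i)) * ell α i, ?_, ?_, ?_, ?_, ?_⟩
  · apply ell_sum_deg
    simp only [mul_sub, Finset.sum_sub_distrib, ← Finset.sum_mul, h0', h2']; ring
  · apply ell_sum_deg
    simp only [mul_sub, Finset.sum_sub_distrib, ← Finset.sum_mul, h1', h3']; ring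
  · simp only [Polynomial.eval_finsetSum, Polynomial.eval_mul, Polynomial.eval_C, mul_assoc,
      ell_eval_mul, ← Finset.sum_mul]
    rw [h0']; field_simp; rw [hLd]
  · simp only [Polynomial.eval_finsetSum, Polynomial.eval_mul, Polynomial.eval_C, mul_assoc,
      ell_eval_mul]
    simp only [← mul_assoc, ← Finset.sum_mul]
    rw [h1']; field_simp; rw [hLd]
  · intro i
    rw [Polynomial.dvd_iff_isRoot, Polynomial.IsRoot]
    simp only [Polynomial.eval_finsetSum, Polynomial.eval_mul, Polynomial.eval_C,
      Polynomial.eval_sub]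
    rw [Finset.sum_eq_single i, Finset.sum_eq_single i]
    · simp only [hβ]; have := hb i; field_simp; ring
    · intro j _ hj; change _ * (ell α j).eval (α i) = 0; rw [ell_eval_ne α hj.symm, mul_zero]
    · simp
    · intro j _ hj; change _ * (ell α j).eval (α i) = 0; rw [ell_eval_ne α hj.symm, mul_zero]
    · simp

lemma lower {K : Type*} [Field K] [Infinite K] (Z : Fin 4 → (K × K) × (K × K))
    (ha : ∀ i, (Z i).1.1 ≠ 0) (hb : ∀ i, (Z i).2.1 ≠ 0) (hS : Solv Z)
    (hinj : ∀ i j, i ≠ j → (Z i).1.2 / (Z i).1.1 ≠ (Z j).1.2 / (Z j).1.1)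
    {m p q : ℕ} {F : MvPolynomial (Fin 4) K} (hF : F.IsWeightedHomogeneous w4 (p, q))
    (hF0 : F ≠ 0) (hm : ∀ i, F ∈ (pointIdeal K (Z i)) ^ m) : 4 * m ≤ p + 2 * q := by
  set α : Fin 4 → K := fun i => (Z i).1.2 / (Z i).1.1 with hα
  have hX : ∀ i, (X 1 - C (α i) * X 0 : MvPolynomial (Fin 4) K) ≠ 0 := by
    intro i h
    have := congrArg (eval ![0, 1, 0, 0]) h
    simp at this
  have hne : F * (X 0 * ∏ i, (X 1 - C (α i) * X 0)) ≠ 0 :=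
    mul_ne_zero hF0 (mul_ne_zero (X_ne_zero _) (Finset.prod_ne_zero_iff.2 fun i _ => hX i))
  obtain ⟨z, hz⟩ : ∃ z, eval z (F * (X 0 * ∏ i, (X 1 - C (α i) * X 0))) ≠ 0 := by
    by_contra! hcon
    exact hne (MvPolynomial.funext fun z => by rw [hcon z, map_zero])
  simp only [map_mul, map_prod, map_sub, eval_X, eval_C] at hz
  have hz1 : eval z F ≠ 0 := left_ne_zero_of_mul hz
  have hz2 := right_ne_zero_of_mul hz
  have hz3 : z 0 ≠ 0 := left_ne_zero_of_mul hz2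
  have hz4 := Finset.prod_ne_zero_iff.1 (right_ne_zero_of_mul hz2)
  set x := z 1 / z 0 with hx
  have hxα : ∀ i, x - α i ≠ 0 := by
    intro i h
    apply hz4 i (Finset.mem_univ i)
    rw [← sub_eq_zero.1 h, hx]; field_simp; ring
  have hzz : z = ![z 0 * 1, z 0 * x, z 2, z 3] := by
    funext i; fin_cases i
    · simp
    · simp [hx]; field_simp
    · rfl
    · rfl
  rw [hzz, eval_scale hF] at hz1
  have hz5 := right_ne_zero_of_mul hz1
  obtain ⟨u, v, hu, hv, hux, hvx, huv⟩ := exists_curve Z ha hb hS x (z 2) (z 3) hxα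
  set ψ : MvPolynomial (Fin 4) K →ₐ[K] Polynomial K := aeval ![1, Polynomial.X, u, v] with hψ
  have hψ0 : ψ F ≠ 0 := by
    intro h
    apply hz5
    have h2 : (Polynomial.aeval x) (ψ F) = 0 := by rw [h, map_zero]
    rw [hψ, ← AlgHom.comp_apply, comp_aeval] at h2
    rw [← h2]
    rw [← aeval_eq_eval]
    congr 2
    funext i; fin_cases i <;> simp [hux, hvx]
  have hdvd : ∀ i, (Polynomial.X - Polynomial.C (α i)) ^ m ∣ ψ F := by
    intro i
    have h1 : (pointIdeal K (Z i)).map ψ.toRingHom ≤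
        Ideal.span {Polynomial.X - Polynomial.C (α i)} := by
      rw [pointIdeal, Ideal.map_span, Ideal.span_le]
      rintro _ ⟨g, hg, rfl⟩
      rw [SetLike.mem_coe, Ideal.mem_span_singleton]
      rcases hg with rfl | rfl
      · refine ⟨Polynomial.C (-(Z i).1.1), ?_⟩
        have h3 : Polynomial.C (Z i).1.2 = Polynomial.C (Z i).1.1 * Polynomial.C (α i) := by
          rw [← map_mul]; congr 1; simp only [hα]; have := ha i; field_simp
        simp [hψ, h3]; ring
      · simpa [hψ] using huv i
    have h2 := Ideal.mem_map_of_mem ψ.toRingHom (hm i)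
    rw [Ideal.map_pow] at h2
    have h3 := Ideal.pow_right_mono h1 m h2
    rw [Ideal.span_singleton_pow, Ideal.mem_span_singleton] at h3
    exact h3
  have hprod : ∏ i, (Polynomial.X - Polynomial.C (α i)) ^ m ∣ ψ F := by
    apply Finset.prod_dvd_of_coprime
    · intro i _ j _ hij
      exact (Polynomial.isCoprime_X_sub_C_of_isUnit_sub
        (sub_ne_zero.2 (hinj i j hij)).isUnit).pow
    · exact fun i _ => hdvd i
  have hd := Polynomial.natDegree_le_of_dvd hprod hψ0
  rw [Polynomial.natDegree_prod _ _
    (fun i _ => pow_ne_zero _ (Polynomial.X_sub_C_ne_zero _))] at hd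
  simp at hd
  exact hd.trans (natDegree_restrict hF u v hu hv)

lemma lower_swap {K : Type*} [Field K] [Infinite K] (Z : Fin 4 → (K × K) × (K × K))
    (ha : ∀ i, (Z i).1.1 ≠ 0) (hb : ∀ i, (Z i).2.1 ≠ 0) (hS : Solv Z)
    (hinj : ∀ i j, i ≠ j → (Z i).2.2 / (Z i).2.1 ≠ (Z j).2.2 / (Z j).2.1)
    {m p q : ℕ} {F : MvPolynomial (Fin 4) K} (hF : F.IsWeightedHomogeneous w4 (p, q))
    (hF0 : F ≠ 0) (hm : ∀ i, F ∈ (pointIdeal K (Z i)) ^ m) : 4 * m ≤ q + 2 * p := by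
  set σ : Fin 4 → Fin 4 := ![2, 3, 0, 1] with hσ
  have hσi : Function.Injective σ := by rw [hσ]; decide
  refine lower (fun i => ((Z i).2, (Z i).1)) hb ha ?_ hinj (F := rename σ F) ?_ ?_ ?_
  · intro y0 y1 y2 y3
    obtain ⟨v, h0, h1, h2, h3⟩ := hS y0 y2 y1 y3
    refine ⟨v, ?_, ?_, ?_, ?_⟩
    · rw [← h0]; exact Finset.sum_congr rfl fun i _ => by ring
    · rw [← h2]; exact Finset.sum_congr rfl fun i _ => by ring
    · rw [← h1]; exact Finset.sum_congr rfl fun i _ => by ring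
    · rw [← h3]; exact Finset.sum_congr rfl fun i _ => by ring
  · intro e he
    obtain ⟨e', rfl, he'⟩ := coeff_rename_ne_zero _ _ _ he
    obtain ⟨h1, h2⟩ := wh_deg hF (mem_support_iff.2 he')
    have hk : ∀ i, (Finsupp.mapDomain σ e') (σ i) = e' i := fun i =>
      Finsupp.mapDomain_apply hσi _ _
    have k0 := hk 0
    have k1 := hk 1
    have k2 := hk 2
    have k3 := hk 3
    change (Finsupp.mapDomain σ e') 2 = _ at k0
    change (Finsupp.mapDomain σ e') 3 = _ at k1
    change (Finsupp.mapDomain σ e') 0 = _ at k2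
    change (Finsupp.mapDomain σ e') 1 = _ at k3
    rw [Finsupp.weight_apply, Finsupp.sum_fintype _ _ (by simp)]
    simp [Fin.sum_univ_four, w4, Prod.ext_iff, k0, k1, k2, k3, h1, h2]
  · intro h
    exact hF0 (rename_injective σ hσi (by rw [h, map_zero]))
  · intro i
    have h2 := Ideal.mem_map_of_mem (rename σ : MvPolynomial (Fin 4) K →ₐ[K] _).toRingHom (hm i)
    rw [Ideal.map_pow] at h2
    refine Ideal.pow_right_mono ?_ m h2
    rw [pointIdeal, Ideal.map_span, Ideal.span_le]
    rintro _ ⟨g, hg, rfl⟩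
    rw [SetLike.mem_coe, pointIdeal]
    rcases hg with rfl | rfl
    · apply Ideal.subset_span
      right
      simp [hσ]
    · apply Ideal.subset_span
      left
      simp [hσ]

/-- matrix of conditions on bidegree `(1,1)` -/
def Vm {R : Type*} [CommRing R] (z : Fin 4 × Fin 4 → R) : Matrix (Fin 4) (Fin 4) R :=
  Matrix.of fun r i => ![z (i, 0) * z (i, 2), z (i, 0) * z (i, 3), z (i, 1) * z (i, 2),
    z (i, 1) * z (i, 3)] r

lemma solv_of_det {K : Type*} [Field K] (Z : Fin 4 → (K × K) × (K × K))
    (h : (Vm (coordsOf K Z)).det ≠ 0) : Solv Z := by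
  intro y0 y1 y2 y3
  have hu : IsUnit (Vm (coordsOf K Z)).det := h.isUnit
  refine ⟨(Vm (coordsOf K Z))⁻¹.mulVec ![y0, y1, y2, y3], ?_⟩
  have h2 : (Vm (coordsOf K Z)).mulVec ((Vm (coordsOf K Z))⁻¹.mulVec ![y0, y1, y2, y3])
      = ![y0, y1, y2, y3] := by
    rw [Matrix.mulVec_mulVec, Matrix.mul_nonsing_inv _ hu, Matrix.one_mulVec]
  set v := (Vm (coordsOf K Z))⁻¹.mulVec ![y0, y1, y2, y3]
  have e : ∀ r, ∑ i, v i * Vm (coordsOf K Z) r i = ![y0, y1, y2, y3] r := by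
    intro r
    rw [← h2, Matrix.mulVec, dotProduct]
    exact Finset.sum_congr rfl fun i _ => mul_comm _ _
  exact ⟨e 0, e 1, e 2, e 3⟩

lemma exists_conic {K : Type*} [Field K] (Z : Fin 4 → (K × K) × (K × K))
    (ha : ∀ i, (Z i).1.1 ≠ 0) (hb : ∀ i, (Z i).2.1 ≠ 0)
    (h : (Vm (coordsOf K Z)).det ≠ 0) (i : Fin 4) :
    ∃ B : MvPolynomial (Fin 4) K, B.IsWeightedHomogeneous w4 (1, 1) ∧ B ≠ 0 ∧
      ∀ j, j ≠ i → B ∈ pointIdeal K (Z j) := by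
  have hu : IsUnit (Vm (coordsOf K Z)).det := h.isUnit
  set c := (Vm (coordsOf K Z))⁻¹ i with hc
  have hcv : ∀ j, c 0 * ((Z j).1.1 * (Z j).2.1) + c 1 * ((Z j).1.1 * (Z j).2.2)
      + c 2 * ((Z j).1.2 * (Z j).2.1) + c 3 * ((Z j).1.2 * (Z j).2.2) = if i = j then 1 else 0 := by
    intro j
    have h2 := congrFun (congrFun (Matrix.nonsing_inv_mul _ hu) i) j
    rw [Matrix.mul_apply, Fin.sum_univ_four, Matrix.one_apply] at h2
    exact h2
  refine ⟨C (c 0) * (X 0 * X 2) + C (c 1) * (X 0 * X 3) + C (c 2) * (X 1 * X 2)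
    + C (c 3) * (X 1 * X 3), ?_, ?_, ?_⟩
  · have hm : ∀ (a : K) (r s : Fin 4), w4 r + w4 s = (1, 1) →
        (C a * (X r * X s) : MvPolynomial (Fin 4) K).IsWeightedHomogeneous w4 (1, 1) := by
      intro a r s hrs
      have := (isWeightedHomogeneous_C (R := K) w4 a).mul
        ((isWeightedHomogeneous_X K w4 r).mul (isWeightedHomogeneous_X K w4 s))
      rwa [hrs, zero_add] at this
    exact (((hm _ _ _ rfl).add (hm _ _ _ rfl)).add (hm _ _ _ rfl)).add (hm _ _ _ rfl)
  · intro h0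
    have h1 := congrArg (eval ![(Z i).1.1, (Z i).1.2, (Z i).2.1, (Z i).2.2]) h0
    have h2 := hcv i
    simp at h1 h2
    rw [h1] at h2
    exact zero_ne_one h2
  · intro j hj
    have h2 := hcv j
    rw [if_neg hj.symm] at h2
    have h3 := congrArg (C (σ := Fin 4)) h2
    simp only [map_add, map_mul, map_zero] at h3
    have hab : (C ((Z j).1.1 * (Z j).2.1)⁻¹ : MvPolynomial (Fin 4) K) *
        (C (Z j).1.1 * C (Z j).2.1) = 1 := by
      rw [← map_mul, ← map_mul, inv_mul_cancel₀ (mul_ne_zero (ha j) (hb j)), map_one]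
    rw [pointIdeal, Ideal.mem_span_pair]
    refine ⟨C ((Z j).1.1 * (Z j).2.1)⁻¹ * (- C (c 2) * C (Z j).2.1 * X 2 - C (c 3) * C (Z j).2.1 * X 3),
      C ((Z j).1.1 * (Z j).2.1)⁻¹ * (- C (c 1) * C (Z j).1.1 * X 0 - C (c 3) * C (Z j).1.2 * X 0), ?_⟩
    set D : MvPolynomial (Fin 4) K := C ((Z j).1.1 * (Z j).2.1)⁻¹
    linear_combination (C (c 0) * (X 0 * X 2) + C (c 1) * (X 0 * X 3) + C (c 2) * (X 1 * X 2)
      + C (c 3) * (X 1 * X 3)) * hab - D * X 0 * X 2 * h3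

lemma exists_upper {K : Type*} [Field K] (Z : Fin 4 → (K × K) × (K × K))
    (ha : ∀ i, (Z i).1.1 ≠ 0) (hb : ∀ i, (Z i).2.1 ≠ 0)
    (h : (Vm (coordsOf K Z)).det ≠ 0) (n : ℕ) :
    ∃ B : MvPolynomial (Fin 4) K, B.IsWeightedHomogeneous w4 (4 * n, 4 * n) ∧ B ≠ 0 ∧
      ∀ j, B ∈ pointIdeal K (Z j) ^ (3 * n) := by
  choose B h1 h2 h3 using exists_conic Z ha hb h
  refine ⟨(∏ i, B i) ^ n, ?_, ?_, ?_⟩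
  · have := (IsWeightedHomogeneous.prod Finset.univ B (fun _ => ((1, 1) : ℕ × ℕ))
      (fun i _ => h1 i)).pow n
    simpa [mul_comm] using this
  · exact pow_ne_zero _ (Finset.prod_ne_zero_iff.2 fun i _ => h2 i)
  · intro j
    rw [pow_mul]
    apply Ideal.pow_mem_pow
    rw [← Finset.mul_prod_erase _ _ (Finset.mem_univ j)]
    apply Ideal.mul_mem_left
    have := Ideal.prod_mem_prod (s := Finset.univ.erase j) (I := fun _ => pointIdeal K (Z j))
      (x := B) (fun i hi => h3 i j (Finset.ne_of_mem_erase hi).symm)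
    simpa using this

lemma tendsto_main {K : Type*} [Field K] [Infinite K] (Z : Fin 4 → (K × K) × (K × K))
    (ha : ∀ i, (Z i).1.1 ≠ 0) (hb : ∀ i, (Z i).2.1 ≠ 0)
    (hV : (Vm (coordsOf K Z)).det ≠ 0)
    (hx : ∀ i j, i ≠ j → (Z i).1.2 / (Z i).1.1 ≠ (Z j).1.2 / (Z j).1.1)
    (hy : ∀ i j, i ≠ j → (Z i).2.2 / (Z i).2.1 ≠ (Z j).2.2 / (Z j).2.1) :
    Filter.Tendsto (fun m : ℕ => (alpha K (symbolicPower K Z m) : ℝ) / m)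
        Filter.atTop (nhds (8 / 3 : ℝ)) := by
  have hS := solv_of_det Z hV
  have hup : ∀ m : ℕ, ∃ t ≤ 8 * ((m + 2) / 3), t ∈ {t | ∃ F ∈ symbolicPower K Z m, F ≠ 0 ∧
      ∃ d : ℕ × ℕ, d.1 + d.2 = t ∧ F.IsWeightedHomogeneous w4 d} := by
    intro m
    obtain ⟨B, h1, h2, h3⟩ := exists_upper Z ha hb hV ((m + 2) / 3)
    refine ⟨_, le_rfl, B, ?_, h2, _, ?_, h1⟩
    · rw [symbolicPower, Ideal.mem_iInf]
      exact fun i => Ideal.pow_le_pow_right (by omega) (h3 i)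
    · simp only; omega
  have hupper : ∀ m : ℕ, 3 * alpha K (symbolicPower K Z m) ≤ 8 * (m + 2) := by
    intro m
    obtain ⟨t, ht, htm⟩ := hup m
    have : alpha K (symbolicPower K Z m) ≤ t := Nat.sInf_le htm
    omega
  have hlower : ∀ m : ℕ, 8 * m ≤ 3 * alpha K (symbolicPower K Z m) := by
    intro m
    obtain ⟨t, ht, htm⟩ := hup m
    obtain ⟨F, hF, hF0, ⟨p, q⟩, hd, hW⟩ := Nat.sInf_mem ⟨t, htm⟩
    change p + q = alpha K (symbolicPower K Z m) at hd
    rw [symbolicPower, Ideal.mem_iInf] at hF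
    have h1 := lower Z ha hb hS hx hW hF0 hF
    have h2 := lower_swap Z ha hb hS hy hW hF0 hF
    omega
  have hlim : Filter.Tendsto (fun m : ℕ => (8 / 3 : ℝ) + (16 / 3) / (m : ℝ)) Filter.atTop
      (nhds (8 / 3 : ℝ)) := by
    simpa using (tendsto_const_div_atTop_nhds_zero_nat (16 / 3 : ℝ)).const_add (8 / 3 : ℝ)
  refine tendsto_of_tendsto_of_tendsto_of_le_of_le' tendsto_const_nhds hlim ?_ ?_
  · filter_upwards [Filter.eventually_gt_atTop 0] with m hm
    have hm' : (0 : ℝ) < m := by exact_mod_cast hm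
    rw [le_div_iff₀ hm']
    have : (8 * m : ℝ) ≤ 3 * alpha K (symbolicPower K Z m) := by exact_mod_cast hlower m
    linarith
  · filter_upwards [Filter.eventually_gt_atTop 0] with m hm
    have hm' : (0 : ℝ) < m := by exact_mod_cast hm
    rw [div_le_iff₀ hm']
    have : (3 * alpha K (symbolicPower K Z m) : ℝ) ≤ 8 * (m + 2) := by exact_mod_cast hupper m
    have e : (8 / 3 + 16 / 3 / (m : ℝ)) * m = 8 / 3 * m + 16 / 3 := by field_simp
    rw [e]; linarith

/-- the form `z_(i,r+1) z_(j,r) - z_(j,r+1) z_(i,r)` -/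
def brk {R : Type*} [CommRing R] (z : Fin 4 × Fin 4 → R) (r s : Fin 4) (i j : Fin 4) : R :=
  z (i, s) * z (j, r) - z (j, s) * z (i, r)

/-- The form whose nonvanishing defines general position. -/
def GG {R : Type*} [CommRing R] (z : Fin 4 × Fin 4 → R) : R :=
  (∏ i, z (i, 0) * z (i, 2)) *
    (∏ e ∈ (Finset.univ : Finset (Fin 4)).offDiag, brk z 0 1 e.1 e.2 * brk z 2 3 e.1 e.2) *
    (Vm z).det

lemma map_GG {R S : Type*} [CommRing R] [CommRing S] (f : R →+* S) (z : Fin 4 × Fin 4 → R) :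
    f (GG z) = GG (fun p => f (z p)) := by
  simp only [GG, map_mul, map_prod, brk, map_sub, RingHom.map_det]
  congr 2
  ext r i
  fin_cases r <;> simp [Vm]

lemma GG_hom {K : Type*} [Field K] :
    ∃ d, (GG (fun p => (X p : MvPolynomial (Fin 4 × Fin 4) K))).IsWeightedHomogeneous (wProd 4) d := by
  have hX := fun p => isWeightedHomogeneous_X K (wProd 4) p
  refine ⟨_, ((IsWeightedHomogeneous.prod _ _ _ fun i _ => (hX (i, 0)).mul (hX (i, 2))).mul
    (IsWeightedHomogeneous.prod _ _
      (fun e => (wProd 4 (e.1, 0) + wProd 4 (e.2, 0)) + (wProd 4 (e.1, 2) + wProd 4 (e.2, 2)))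
      fun e _ => ?_)).mul (n := ∑ i, Pi.single i (1, 1)) ?_⟩
  · have hs : ∀ r s : Fin 4, w4 r = w4 s →
        (brk (fun p => (X p : MvPolynomial (Fin 4 × Fin 4) K)) r s e.1 e.2).IsWeightedHomogeneous
          (wProd 4) (wProd 4 (e.1, r) + wProd 4 (e.2, r)) := by
      intro r s hrs
      have hw : ∀ i : Fin 4, wProd 4 (i, s) = wProd 4 (i, r) := fun i => by simp [wProd, hrs]
      have h1 := (hX (e.1, s)).mul (hX (e.2, r))
      have h2 := (hX (e.2, s)).mul (hX (e.1, r))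
      rw [hw] at h1 h2
      rw [add_comm (wProd 4 (e.2, r))] at h2
      exact Submodule.sub_mem (weightedHomogeneousSubmodule K (wProd 4) _) h1 h2
    exact (hs 0 1 rfl).mul (hs 2 3 rfl)
  · rw [Matrix.det_apply]
    refine Submodule.sum_mem (weightedHomogeneousSubmodule K (wProd 4) _) fun σ _ => ?_
    rw [Units.smul_def]
    refine zsmul_mem (S := Submodule K (MvPolynomial (Fin 4 × Fin 4) K)) (K := weightedHomogeneousSubmodule K (wProd 4) _) ?_ _
    refine IsWeightedHomogeneous.prod _ _ _ fun i _ => ?_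
    have hm : ∀ r s : Fin 4, w4 r + w4 s = (1, 1) →
        (X (i, r) * X (i, s) : MvPolynomial (Fin 4 × Fin 4) K).IsWeightedHomogeneous (wProd 4)
          (Pi.single i (1, 1)) := by
      intro r s h
      have := (hX (i, r)).mul (hX (i, s))
      rwa [wProd, wProd, ← Pi.single_add, h] at this
    generalize σ i = r
    fin_cases r
    · exact hm 0 2 rfl
    · exact hm 0 3 rfl
    · exact hm 1 2 rfl
    · exact hm 1 3 rfl

lemma exists_witness {K : Type*} [Field K] [Infinite K] :
    ∃ Z : Fin 4 → (K × K) × (K × K), (∀ i, IsPtRep K (Z i)) ∧ GG (coordsOf K Z) ≠ 0 := by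
  classical
  obtain ⟨t, ht⟩ := Infinite.exists_notMem_finset ({0, 1} : Finset K)
  obtain ⟨u, hu⟩ := Infinite.exists_notMem_finset ({0, 1, t} : Finset K)
  obtain ⟨v, hv⟩ := Infinite.exists_notMem_finset ({0, 1, t, u} : Finset K)
  simp only [Finset.mem_insert, Finset.mem_singleton, not_or] at ht hu hv
  obtain ⟨t0, t1⟩ := ht
  obtain ⟨u0, u1, ut⟩ := hu
  obtain ⟨v0, v1, vt, vu⟩ := hv
  refine ⟨![((1, 0), (1, 0)), ((1, 1), (1, 1)), ((1, t), (1, t)), ((1, u), (1, v))], ?_, ?_⟩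
  · intro i
    fin_cases i <;> simp [IsPtRep, Prod.ext_iff]
  · rw [GG]
    refine mul_ne_zero (mul_ne_zero ?_ ?_) ?_
    · rw [Finset.prod_ne_zero_iff]
      intro i _
      fin_cases i <;> simp [coordsOf]
    · rw [Finset.prod_ne_zero_iff]
      rintro ⟨i, j⟩ hij
      have hij : i ≠ j := by simpa using hij
      fin_cases i <;> fin_cases j <;>
        first
        | exact absurd rfl hij
        | simp [coordsOf, brk, sub_eq_zero, t0, t1, u0, u1, ut, v0, v1, vt, Ne.symm t1,
            Ne.symm u1, Ne.symm ut, Ne.symm v1, Ne.symm vt]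
    · have : (Vm (coordsOf K ![((1, 0), (1, 0)), ((1, 1), (1, 1)), ((1, t), (1, t)),
          ((1, u), (1, v))])).det = t * (t - 1) * (v - u) := by
        simp [Matrix.det_succ_row_zero, Fin.sum_univ_succ, Vm, coordsOf, Fin.succAbove]
        ring
      rw [this]
      exact mul_ne_zero (mul_ne_zero t0 (sub_ne_zero.2 t1)) (sub_ne_zero.2 vu)

/-- For `4` general points of `P^1 × P^1`, `γ(I) = 8/3`. -/
theorem gamma_general_points_4 {k : Type*} [Field k] [IsAlgClosed k] :
    GeneralPosition k 4 (fun Z =>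
      Filter.Tendsto
        (fun m : ℕ => (alpha k (symbolicPower k Z m) : ℝ) / m)
        Filter.atTop (nhds (8 / 3 : ℝ))) := by
  have : Infinite k := IsAlgClosed.instInfinite
  obtain ⟨d, hd⟩ := GG_hom (K := k)
  have hev : ∀ Z : Fin 4 → (k × k) × (k × k),
      eval (coordsOf k Z) (GG (fun p => (X p : MvPolynomial (Fin 4 × Fin 4) k)))
        = GG (coordsOf k Z) := by
    intro Z
    rw [map_GG]
    simp
  refine ⟨GG (fun p => X p), d, hd, ?_, ?_⟩
  · obtain ⟨Z, h1, h2⟩ := exists_witness (K := k)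
    exact ⟨Z, h1, by rwa [hev]⟩
  · intro Z _ _ hG
    rw [hev, GG] at hG
    have hV := right_ne_zero_of_mul hG
    have h1 := Finset.prod_ne_zero_iff.1 (left_ne_zero_of_mul (left_ne_zero_of_mul hG))
    have h2 := Finset.prod_ne_zero_iff.1 (right_ne_zero_of_mul (left_ne_zero_of_mul hG))
    have ha : ∀ i, (Z i).1.1 ≠ 0 := fun i => left_ne_zero_of_mul (h1 i (Finset.mem_univ i))
    have hb : ∀ i, (Z i).2.1 ≠ 0 := fun i => right_ne_zero_of_mul (h1 i (Finset.mem_univ i))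
    refine tendsto_main Z ha hb hV ?_ ?_
    · intro i j hij h
      rw [div_eq_div_iff (ha i) (ha j)] at h
      exact left_ne_zero_of_mul (h2 (i, j) (by simpa using hij)) (sub_eq_zero.2 h)
    · intro i j hij h
      rw [div_eq_div_iff (hb i) (hb j)] at h
      exact right_ne_zero_of_mul (h2 (i, j) (by simpa using hij)) (sub_eq_zero.2 h)
end
end

section
/- For 5 general points of P^1 x P^1, the ideal I of the points satisfies γ(I) = 3; that is, there is a nonempty Zariski-open subset U of (P^1 x P^1)^5 such that for every 5-tuple of pairwise distinct points lying in U, with I the ideal of these points, α(I^(m))/m tends to 3 as m → ∞. -/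
open MvPolynomial

noncomputable section

variable (k : Type*) [Field k]

noncomputable section affine

local notation "PX" => Polynomial.X
local notation "PC" => Polynomial.C

theorem rees_mem {S : Type*} [CommRing S] (J : Ideal S) (φ : S →+* Polynomial S)
    (h1 : ∀ f, φ f ∈ reesAlgebra J) (h2 : ∀ f, (φ f).eval 1 = f) {f : S} {n : ℕ}
    (h : (Polynomial.X : Polynomial S) ^ n ∣ φ f) : f ∈ J ^ n := by
  rw [← h2 f, Polynomial.eval_eq_sum_range]
  refine Ideal.sum_mem _ fun i _ => ?_
  rw [one_pow, mul_one]
  by_cases hi : i < n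
  · rw [Polynomial.X_pow_dvd_iff.1 h i hi]; exact zero_mem _
  · exact Ideal.pow_le_pow_right (not_lt.1 hi) ((mem_reesAlgebra_iff J _).1 (h1 f) i)

theorem rees_lower {S : Type*} [CommRing S] [IsDomain S] (J : Ideal S) (φ : S →+* Polynomial S)
    (h1 : ∀ f, φ f ∈ reesAlgebra J) (h2 : ∀ f, (φ f).eval 1 = f)
    (h3 : J ≤ Ideal.comap φ (Ideal.span {Polynomial.X})) {c g : S} {m : ℕ}
    (hc : c ∈ J) (hc2 : c ∉ J ^ 2) (h : c * g ∈ J ^ (m + 1)) : g ∈ J ^ m := by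
  apply rees_mem J φ h1 h2
  have hpow : ∀ n, J ^ n ≤ Ideal.comap φ (Ideal.span {(Polynomial.X : Polynomial S) ^ n}) := by
    intro n
    rw [← Ideal.span_singleton_pow]
    exact (Ideal.pow_right_mono h3 n).trans (Ideal.le_comap_pow _ _)
  have hX := Polynomial.prime_X (R := S)
  have a1 : (Polynomial.X : Polynomial S) ∣ φ c := Ideal.mem_span_singleton.1 (h3 hc)
  obtain ⟨c', hc'⟩ := a1
  have a2 : (Polynomial.X : Polynomial S) ^ (m + 1) ∣ φ (c * g) :=
    Ideal.mem_span_singleton.1 (hpow _ h)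
  have a3 : ¬ (Polynomial.X : Polynomial S) ∣ c' := by
    rintro ⟨d, rfl⟩
    apply hc2
    apply rees_mem J φ h1 h2
    rw [hc']
    exact ⟨d, by ring⟩
  rw [map_mul, hc', pow_succ', mul_assoc, mul_dvd_mul_iff_left hX.ne_zero] at a2
  exact hX.pow_dvd_of_dvd_mul_left m a3 a2

variable {k : Type*} [Field k]

/-- The ideal of the affine point `x = α`, `s = β` in `k[s][x]`. -/
def affIdeal (α β : k) : Ideal (Polynomial (Polynomial k)) :=
  Ideal.span {PX - PC (PC α), PC (PX - PC β)}

theorem affIdeal_eval (α β : k) {f : Polynomial (Polynomial k)} (hf : f ∈ affIdeal α β) :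
    f.evalEval β α = 0 := by
  have : affIdeal α β ≤ RingHom.ker (Polynomial.evalEvalRingHom β α) := by
    rw [affIdeal, Ideal.span_le]
    rintro x (rfl | rfl) <;> simp [RingHom.mem_ker]
  exact this hf

theorem affIdeal_sq (α β : k) {f : Polynomial (Polynomial k)} (hf : f ∈ affIdeal α β ^ 2) :
    (Polynomial.derivative f).evalEval β α = 0 := by
  rw [pow_two] at hf
  refine Submodule.mul_induction_on hf ?_ ?_
  · intro p hp q hq
    simp [affIdeal_eval α β hp, affIdeal_eval α β hq, Polynomial.derivative_mul]
  · intro x y hx hy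
    simp [hx, hy]

theorem affIdeal_lower (α β : k) {c g : Polynomial (Polynomial k)} {m : ℕ}
    (hc : c ∈ affIdeal α β) (hc2 : c ∉ affIdeal α β ^ 2)
    (h : c * g ∈ affIdeal α β ^ (m + 1)) : g ∈ affIdeal α β ^ m := by
  set J := affIdeal α β with hJ
  let u : Polynomial (Polynomial k) := PC (PX - PC β)
  let v : Polynomial (Polynomial k) := PX - PC (PC α)
  have hu : u ∈ J := Ideal.subset_span (by simp [u])
  have hv : v ∈ J := Ideal.subset_span (by simp [v])
  let φ : Polynomial (Polynomial k) →+* Polynomial (Polynomial (Polynomial k)) :=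
    Polynomial.eval₂RingHom
      (Polynomial.eval₂RingHom (Polynomial.C.comp (Polynomial.C.comp Polynomial.C))
        (PC (PC (PC β)) + PC u * PX))
      (PC (PC (PC α)) + PC v * PX)
  have hx : φ PX = PC (PC (PC α)) + PC v * PX := by simp [φ]
  have hs : φ (PC PX) = PC (PC (PC β)) + PC u * PX := by simp [φ]
  have hcc : ∀ a : k, φ (PC (PC a)) = PC (PC (PC a)) := by simp [φ]
  have hCm : ∀ a, PC a ∈ reesAlgebra J := fun a => (reesAlgebra J).algebraMap_mem a
  have hXm : ∀ a ∈ J, PC a * PX ∈ reesAlgebra J := by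
    intro a ha
    rw [Polynomial.C_mul_X_eq_monomial]
    exact reesAlgebra.monomial_mem.2 (by simpa using ha)
  refine rees_lower J φ ?_ ?_ ?_ hc hc2 h
  · intro f
    have hC : ∀ p : Polynomial k, φ (PC p) ∈ reesAlgebra J := by
      intro p
      induction p using Polynomial.induction_on with
      | C a => rw [hcc]; exact hCm _
      | add p q hp hq => rw [map_add, map_add]; exact add_mem hp hq
      | monomial n a _ =>
        rw [map_mul, map_mul, map_pow, map_pow, hs, hcc]
        exact mul_mem (hCm _) (pow_mem (add_mem (hCm _) (hXm _ hu)) _)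
    induction f using Polynomial.induction_on with
    | C a => exact hC a
    | add p q hp hq => rw [map_add]; exact add_mem hp hq
    | monomial n a _ =>
      rw [map_mul, map_pow, hx]
      exact mul_mem (hC _) (pow_mem (add_mem (hCm _) (hXm _ hv)) _)
  · intro f
    have : (Polynomial.evalRingHom (1 : Polynomial (Polynomial k))).comp φ = RingHom.id _ := by
      ext
      · simp [φ]
      · simp [φ, u]
      · simp [φ, v]
    exact congrArg (fun g => g f) (congrArg DFunLike.coe this)
  · rw [hJ, affIdeal, Ideal.span_le]
    rintro x (rfl | rfl)
    · simp only [SetLike.mem_coe, Ideal.mem_comap, Ideal.mem_span_singleton]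
      rw [map_sub, hx, hcc]
      exact ⟨PC v, by ring⟩
    · simp only [SetLike.mem_coe, Ideal.mem_comap, Ideal.mem_span_singleton]
      rw [map_sub, map_sub, hs, hcc]
      exact ⟨PC u, by ring⟩

theorem coeff_swap (f : Polynomial (Polynomial k)) (i j : ℕ) :
    ((Polynomial.Bivariate.swap f).coeff i).coeff j = (f.coeff j).coeff i := by
  induction f using Polynomial.induction_on' with
  | add p q hp hq => simp [hp, hq]
  | monomial n a =>
    induction a using Polynomial.induction_on' with
    | add p q hp hq =>
      rw [map_add, map_add]
      simp only [Polynomial.coeff_add]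
      rw [hp, hq]
    | monomial m r =>
      rw [Polynomial.Bivariate.swap_monomial_monomial]
      simp only [Polynomial.coeff_monomial]
      split_ifs <;> simp_all [Polynomial.coeff_monomial]

theorem natDegree_coeff_le (f : Polynomial (Polynomial k)) (j : ℕ) :
    (f.coeff j).natDegree ≤ (Polynomial.Bivariate.swap f).natDegree := by
  rw [Polynomial.natDegree_le_iff_coeff_eq_zero]
  intro N hN
  rw [← coeff_swap, Polynomial.coeff_eq_zero_of_natDegree_lt hN, Polynomial.coeff_zero]

theorem natDegree_swap_lin (A B : Polynomial k) (hA : A.natDegree ≤ 2) (hB : B.natDegree ≤ 2)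
    (h : A.coeff 2 ≠ 0 ∨ B.coeff 2 ≠ 0) :
    (Polynomial.Bivariate.swap (PC A * PX + PC B)).natDegree = 2 := by
  apply le_antisymm
  · rw [Polynomial.natDegree_le_iff_coeff_eq_zero]
    intro N hN
    ext j
    rw [coeff_swap]
    have h1 := Polynomial.coeff_eq_zero_of_natDegree_lt (hA.trans_lt hN)
    have h2 := Polynomial.coeff_eq_zero_of_natDegree_lt (hB.trans_lt hN)
    rcases j with _ | _ | j <;> simp [Polynomial.coeff_C, Polynomial.coeff_X, h1, h2]
  · rcases h with h | h
    · apply Polynomial.le_natDegree_of_ne_zero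
      intro h0
      apply h
      have := congrArg (fun p => Polynomial.coeff p 1) h0
      simpa only [coeff_swap, Polynomial.coeff_add, Polynomial.coeff_C_mul, Polynomial.coeff_X_one,
        mul_one, Polynomial.coeff_C_succ, add_zero, Polynomial.coeff_zero] using this
    · apply Polynomial.le_natDegree_of_ne_zero
      intro h0
      apply h
      have := congrArg (fun p => Polynomial.coeff p 0) h0
      simpa only [coeff_swap, Polynomial.coeff_add, Polynomial.mul_coeff_zero,
        Polynomial.coeff_X_zero, mul_zero, zero_add, Polynomial.coeff_C_zero,
        Polynomial.coeff_zero] using this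

/-- The resultant-like restriction of `f` to the curve `A x + B = 0`. -/
def restr (A B : Polynomial k) (a : ℕ) (f : Polynomial (Polynomial k)) : Polynomial k :=
  ∑ j ∈ Finset.range (a + 1), f.coeff j * ((-B) ^ j * A ^ (a - j))

theorem restr_dvd (A B : Polynomial k) (f : Polynomial (Polynomial k)) :
    (PC A * PX + PC B) ∣ PC (A ^ f.natDegree) * f - PC (restr A B f.natDegree f) := by
  have hf : PC (A ^ f.natDegree) * f
      = ∑ j ∈ Finset.range (f.natDegree + 1), PC (A ^ f.natDegree) * (PC (f.coeff j) * PX ^ j) := by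
    rw [← Finset.mul_sum, ← f.as_sum_range_C_mul_X_pow]
  rw [hf, restr, map_sum, ← Finset.sum_sub_distrib]
  refine Finset.dvd_sum fun j hj => ?_
  have hj' : j ≤ f.natDegree := Nat.lt_succ_iff.1 (Finset.mem_range.1 hj)
  have e : PC (A ^ f.natDegree) * (PC (f.coeff j) * PX ^ j)
      - PC (f.coeff j * ((-B) ^ j * A ^ (f.natDegree - j)))
      = PC (f.coeff j * A ^ (f.natDegree - j)) * ((PC A * PX) ^ j - (- PC B) ^ j) := by
    obtain ⟨t, ht⟩ := Nat.exists_eq_add_of_le hj'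
    rw [ht, Nat.add_sub_cancel_left]
    simp only [map_mul, map_pow, map_neg]
    ring
  rw [e]
  apply Dvd.dvd.mul_left
  have := sub_dvd_pow_sub_pow (PC A * PX) (-PC B) j
  rwa [sub_neg_eq_add] at this

theorem restr_natDegree (A B : Polynomial k) (hA : A.natDegree ≤ 2) (hB : B.natDegree ≤ 2)
    (f : Polynomial (Polynomial k)) :
    (restr A B f.natDegree f).natDegree
      ≤ 2 * f.natDegree + (Polynomial.Bivariate.swap f).natDegree := by
  refine Polynomial.natDegree_sum_le_of_forall_le _ _ fun j hj => ?_
  have hj' : j ≤ f.natDegree := Nat.lt_succ_iff.1 (Finset.mem_range.1 hj)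
  have h1 := natDegree_coeff_le f j
  have h2 : ((-B) ^ j).natDegree ≤ j * 2 :=
    Polynomial.natDegree_pow_le_of_le j (by simpa using hB)
  have h3 : (A ^ (f.natDegree - j)).natDegree ≤ (f.natDegree - j) * 2 :=
    Polynomial.natDegree_pow_le_of_le _ hA
  have h4 := Polynomial.natDegree_mul_le_of_le h2 h3
  have h5 := Polynomial.natDegree_mul_le_of_le h1 h4
  refine h5.trans ?_
  omega

theorem restr_order (A B : Polynomial k) (hAB : IsCoprime A B) (α β : k)
    (h : A.eval β * α + B.eval β = 0) (f : Polynomial (Polynomial k)) (m : ℕ)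
    (hf : f ∈ affIdeal α β ^ (m + 1)) :
    (PX - PC β) ^ (m + 1) ∣ restr A B f.natDegree f := by
  have hA : A.eval β ≠ 0 := by
    intro h0
    obtain ⟨u, v, huv⟩ := hAB
    have := congrArg (Polynomial.eval β) huv
    have hB : B.eval β = 0 := by simpa [h0] using h
    simp [h0, hB] at this
  have hcop : IsCoprime A ((PX - PC β) ^ (m + 1)) := by
    apply IsCoprime.pow_right
    apply IsCoprime.symm
    exact (Polynomial.irreducible_X_sub_C β).coprime_iff_not_dvd.2
      (fun hd => hA (Polynomial.dvd_iff_isRoot.1 hd))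
  obtain ⟨U, V, hUV⟩ := hcop
  have hJ : affIdeal α β ≤ Ideal.comap (Polynomial.evalRingHom (-(U * B)))
      (Ideal.span {PX - PC β}) := by
    rw [affIdeal, Ideal.span_le]
    rintro x (rfl | rfl)
    · simp only [SetLike.mem_coe, Ideal.mem_comap, Ideal.mem_span_singleton]
      have hr : (PX - PC β) ∣ A * PC α + B := by
        rw [Polynomial.dvd_iff_isRoot]; simpa using h
      obtain ⟨w, hw⟩ := hr
      refine ⟨-U * w - V * (PX - PC β) ^ m * PC α, ?_⟩
      simp only [Polynomial.coe_evalRingHom, Polynomial.eval_sub, Polynomial.eval_X,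
        Polynomial.eval_C]
      linear_combination (-U) * hw + PC α * hUV
    · simp
  have h1 : (PX - PC β) ^ (m + 1) ∣ f.eval (-(U * B)) := by
    have := ((Ideal.pow_right_mono hJ (m + 1)).trans (Ideal.le_comap_pow _ _)) hf
    rw [Ideal.span_singleton_pow, Ideal.mem_comap, Ideal.mem_span_singleton] at this
    exact this
  obtain ⟨q, hq⟩ := restr_dvd A B f
  have h2 := congrArg (Polynomial.eval (-(U * B))) hq
  simp only [Polynomial.eval_sub, Polynomial.eval_mul, Polynomial.eval_add, Polynomial.eval_C,
    Polynomial.eval_X] at h2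
  obtain ⟨e, he⟩ := h1
  refine ⟨A ^ f.natDegree * e - B * V * q.eval (-(U * B)), ?_⟩
  rw [he] at h2
  linear_combination -h2 + B * q.eval (-(U * B)) * hUV

theorem lin_prime (A B : Polynomial k) (hAB : IsCoprime A B) (hA : A ≠ 0) :
    Prime (PC A * PX + PC B) := by
  rw [← irreducible_iff_prime]
  apply Polynomial.irreducible_of_degree_eq_one_of_isRelPrime_coeff
  · exact Polynomial.degree_linear hA
  · simpa using hAB.symm.isRelPrime

theorem affine_step (A B : Polynomial k) (hA2 : A.natDegree ≤ 2) (hB2 : B.natDegree ≤ 2)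
    (hAB : IsCoprime A B) (α β : Fin 5 → k) (hβ : Function.Injective β)
    (h : ∀ i, A.eval (β i) * α i + B.eval (β i) = 0)
    (f : Polynomial (Polynomial k)) (m : ℕ) (hf : ∀ i, f ∈ affIdeal (α i) (β i) ^ (m + 1))
    (hlt : 2 * f.natDegree + (Polynomial.Bivariate.swap f).natDegree < 5 * (m + 1)) :
    ∃ g, f = (PC A * PX + PC B) * g ∧ ∀ i, g ∈ affIdeal (α i) (β i) ^ m := by
  have hA : ∀ i, A.eval (β i) ≠ 0 := by
    intro i h0
    obtain ⟨u, v, huv⟩ := hAB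
    have := congrArg (Polynomial.eval (β i)) huv
    have hB : B.eval (β i) = 0 := by simpa [h0] using h i
    simp [h0, hB] at this
  have hA0 : A ≠ 0 := by rintro rfl; exact hA 0 (by simp)
  have hr : restr A B f.natDegree f = 0 := by
    by_contra hne
    have hd : (∏ i : Fin 5, (PX - PC (β i)) ^ (m + 1)) ∣ restr A B f.natDegree f := by
      apply Finset.prod_dvd_of_coprime
      · intro i _ j _ hij
        exact IsCoprime.pow (Polynomial.isCoprime_X_sub_C_of_isUnit_sub
          (sub_ne_zero.2 (hβ.ne hij)).isUnit)
      · intro i _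
        exact restr_order A B hAB _ _ (h i) f m (hf i)
    have h1 := Polynomial.natDegree_le_of_dvd hd hne
    have h2 : (∏ i : Fin 5, (PX - PC (β i)) ^ (m + 1)).natDegree = 5 * (m + 1) := by
      rw [Polynomial.natDegree_prod_of_monic]
      · simp [Polynomial.natDegree_pow]
      · intro i _
        exact (Polynomial.monic_X_sub_C _).pow _
    have h3 := restr_natDegree A B hA2 hB2 f
    omega
  have hd := restr_dvd A B f
  rw [hr, map_zero, sub_zero] at hd
  have hp := lin_prime A B hAB hA0
  rcases hp.dvd_or_dvd hd with h1 | ⟨g, hg⟩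
  · exfalso
    have h2 := Polynomial.natDegree_le_of_dvd h1 (by simp [hA0])
    rw [Polynomial.natDegree_linear hA0, Polynomial.natDegree_C] at h2
    omega
  · refine ⟨g, hg, fun i => ?_⟩
    apply affIdeal_lower (α i) (β i) (c := PC A * PX + PC B) _ _ (hg ▸ hf i)
    · have hr : (PX - PC (β i)) ∣ A * PC (α i) + B := by
        rw [Polynomial.dvd_iff_isRoot]; simpa using h i
      obtain ⟨w, hw⟩ := hr
      have e : PC A * PX + PC B = PC A * (PX - PC (PC (α i))) + PC w * PC (PX - PC (β i)) := by
        have := congrArg PC hw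
        simp only [map_add, map_mul, map_sub] at this ⊢
        linear_combination this
      rw [e]
      exact add_mem (Ideal.mul_mem_left _ _ (Ideal.subset_span (by simp)))
        (Ideal.mul_mem_left _ _ (Ideal.subset_span (by simp)))
    · intro h2
      have := affIdeal_sq _ _ h2
      rw [Polynomial.derivative_add, Polynomial.derivative_C_mul, Polynomial.derivative_X,
        Polynomial.derivative_C, mul_one, add_zero, Polynomial.evalEval_C] at this
      exact hA i this

/-- No four of the five points lie on a curve of bidegree `(1,1)`. -/
def NoFour (α β : Fin 5 → k) : Prop := ∀ i p q r u,
  (∀ j, j ≠ i → p + q * α j + r * β j + u * (α j * β j) = 0) → p = 0 ∧ q = 0 ∧ r = 0 ∧ u = 0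

theorem exists_coeffs (α β : Fin 5 → k) : ∃ c : Fin 6 → k, c ≠ 0 ∧ ∀ i,
    (c 0 + c 1 * β i + c 2 * β i ^ 2) * α i + (c 3 + c 4 * β i + c 5 * β i ^ 2) = 0 := by
  let M : Matrix (Fin 5) (Fin 6) k := Matrix.of fun i =>
    ![α i, β i * α i, β i ^ 2 * α i, 1, β i, β i ^ 2]
  have hM : LinearMap.ker (Matrix.mulVecLin M) ≠ ⊥ :=
    LinearMap.ker_ne_bot_of_finrank_lt (by simp)
  obtain ⟨c, hc, hc0⟩ := Submodule.exists_mem_ne_zero_of_ne_bot hM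
  refine ⟨c, hc0, fun i => ?_⟩
  have := congrFun (LinearMap.mem_ker.1 hc) i
  simp [M, Matrix.mulVec, dotProduct, Fin.sum_univ_succ] at this
  linear_combination this

theorem exists_curve_s3 [IsAlgClosed k] (α β : Fin 5 → k) (hβ : Function.Injective β)
    (hN : NoFour α β) : ∃ A B : Polynomial k, A.natDegree ≤ 2 ∧ B.natDegree ≤ 2 ∧
      (A.coeff 2 ≠ 0 ∨ B.coeff 2 ≠ 0) ∧ IsCoprime A B ∧
      ∀ i, A.eval (β i) * α i + B.eval (β i) = 0 := by
  obtain ⟨c, hc0, hc⟩ := exists_coeffs α β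
  refine ⟨PC (c 2) * PX ^ 2 + PC (c 1) * PX + PC (c 0),
    PC (c 5) * PX ^ 2 + PC (c 4) * PX + PC (c 3), Polynomial.natDegree_quadratic_le,
    Polynomial.natDegree_quadratic_le, ?_, ?_, ?_⟩
  · simp only [Polynomial.coeff_add, Polynomial.coeff_C_mul, Polynomial.coeff_X_pow,
      Polynomial.coeff_X, Polynomial.coeff_C]
    norm_num
    by_contra! h
    obtain ⟨h1, h2, h3, h4⟩ := hN 0 (c 3) (c 0) (c 4) (c 1) (fun j _ => by
      have := hc j
      rw [h.1, h.2] at this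
      linear_combination this)
    apply hc0
    ext i
    fin_cases i <;> simp [*]
  · rw [Polynomial.isCoprime_iff_aeval_ne_zero_of_isAlgClosed k k]
    intro γ
    by_contra! h
    simp at h
    obtain ⟨ha, hb⟩ := h
    have key : ∃ i, ∀ j, j ≠ i → β j ≠ γ := by
      by_cases hex : ∃ i, β i = γ
      · obtain ⟨i, hi⟩ := hex
        exact ⟨i, fun j hj h => hj (hβ (h.trans hi.symm))⟩
      · push Not at hex
        exact ⟨0, fun j _ => hex j⟩
    obtain ⟨i, hi⟩ := key
    obtain ⟨h1, h2, h3, h4⟩ := hN i (c 4 + c 5 * γ) (c 1 + c 2 * γ) (c 5) (c 2) (fun j hj => by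
      have := hc j
      apply mul_left_cancel₀ (sub_ne_zero.2 (hi j hj))
      linear_combination this - α j * ha - hb)
    rw [h3, zero_mul, add_zero] at h1
    rw [h4, zero_mul, add_zero] at h2
    have h5 : c 0 = 0 := by simpa [h4, h2] using ha
    have h6 : c 3 = 0 := by simpa [h3, h1] using hb
    apply hc0
    ext i
    fin_cases i <;> simp [*]
  · intro i
    have := hc i
    simp
    linear_combination this

theorem swap_ne_zero {f : Polynomial (Polynomial k)} (hf : f ≠ 0) :
    Polynomial.Bivariate.swap f ≠ 0 := by
  intro h
  apply hf
  rw [← Polynomial.Bivariate.swap_swap_apply f, h, map_zero]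

theorem affine_step' [IsAlgClosed k] (α β : Fin 5 → k) (hβ : Function.Injective β)
    (hN : NoFour α β) (f : Polynomial (Polynomial k)) (hf0 : f ≠ 0) (m : ℕ)
    (hf : ∀ i, f ∈ affIdeal (α i) (β i) ^ (m + 1))
    (hlt : 2 * f.natDegree + (Polynomial.Bivariate.swap f).natDegree < 5 * (m + 1)) :
    ∃ g, g ≠ 0 ∧ (∀ i, g ∈ affIdeal (α i) (β i) ^ m) ∧
      f.natDegree + (Polynomial.Bivariate.swap f).natDegree
        = g.natDegree + (Polynomial.Bivariate.swap g).natDegree + 3 := by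
  obtain ⟨A, B, hA2, hB2, hAB2, hAB, h⟩ := exists_curve_s3 α β hβ hN
  obtain ⟨g, hg, hgm⟩ := affine_step A B hA2 hB2 hAB α β hβ h f m hf hlt
  have hg0 : g ≠ 0 := by rintro rfl; simp at hg; exact hf0 hg
  have hA0 : A ≠ 0 := by
    rintro rfl
    have hB : IsUnit B := isCoprime_zero_left.1 hAB
    obtain ⟨b, hb, rfl⟩ := Polynomial.isUnit_iff.1 hB
    have := h 0
    simp at this
    exact hb.ne_zero this
  have hc0 : PC A * PX + PC B ≠ 0 := by rintro h0; rw [h0, zero_mul] at hg; exact hf0 hg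
  refine ⟨g, hg0, hgm, ?_⟩
  rw [hg, map_mul, Polynomial.natDegree_mul hc0 hg0, Polynomial.natDegree_mul (swap_ne_zero hc0)
    (swap_ne_zero hg0), natDegree_swap_lin A B hA2 hB2 hAB2, Polynomial.natDegree_linear hA0]
  ring

theorem swap_mem (α β : k) (m : ℕ) {f : Polynomial (Polynomial k)} (hf : f ∈ affIdeal α β ^ m) :
    Polynomial.Bivariate.swap f ∈ affIdeal β α ^ m := by
  let σ : Polynomial (Polynomial k) →+* Polynomial (Polynomial k) :=
    RingHomClass.toRingHom (Polynomial.Bivariate.swap (R := k))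
  have h : affIdeal α β ≤ Ideal.comap σ (affIdeal β α) := by
    rw [affIdeal, Ideal.span_le]
    rintro x (rfl | rfl)
    · rw [SetLike.mem_coe, Ideal.mem_comap]
      have : σ (PX - PC (PC α)) = PC (PX - PC α) := by
        rw [map_sub]
        change Polynomial.Bivariate.swap _ - Polynomial.Bivariate.swap _ = _
        rw [Polynomial.Bivariate.swap_Y, Polynomial.Bivariate.swap_C_C, map_sub]
      rw [this]
      exact Ideal.subset_span (by simp)
    · rw [SetLike.mem_coe, Ideal.mem_comap]
      have : σ (PC (PX - PC β)) = PX - PC (PC β) := by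
        rw [map_sub, map_sub]
        change Polynomial.Bivariate.swap _ - Polynomial.Bivariate.swap _ = _
        rw [Polynomial.Bivariate.swap_X, Polynomial.Bivariate.swap_C_C]
      rw [this]
      exact Ideal.subset_span (by simp)
  exact ((Ideal.pow_right_mono h m).trans (Ideal.le_comap_pow σ m)) hf

theorem affine_bound [IsAlgClosed k] (α β : Fin 5 → k) (hα : Function.Injective α)
    (hβ : Function.Injective β) (hN : NoFour α β) (m : ℕ) :
    ∀ f : Polynomial (Polynomial k), f ≠ 0 → (∀ i, f ∈ affIdeal (α i) (β i) ^ m) →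
      3 * m ≤ f.natDegree + (Polynomial.Bivariate.swap f).natDegree := by
  have hN' : NoFour β α := by
    intro i p q r u h
    obtain ⟨h1, h2, h3, h4⟩ := hN i p r q u (fun j hj => by linear_combination h j hj)
    exact ⟨h1, h3, h2, h4⟩
  induction m with
  | zero => intros; omega
  | succ m ih =>
    intro f hf0 hf
    by_cases h1 : 2 * f.natDegree + (Polynomial.Bivariate.swap f).natDegree < 5 * (m + 1)
    · obtain ⟨g, hg0, hg, hd⟩ := affine_step' α β hβ hN f hf0 m hf h1
      have := ih g hg0 hg
      omega
    by_cases h2 : 2 * (Polynomial.Bivariate.swap f).natDegree + f.natDegree < 5 * (m + 1)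
    · obtain ⟨g, hg0, hg, hd⟩ := affine_step' β α hα hN' (Polynomial.Bivariate.swap f)
        (swap_ne_zero hf0) m (fun i => swap_mem _ _ _ (hf i))
        (by rwa [Polynomial.Bivariate.swap_swap_apply])
      rw [Polynomial.Bivariate.swap_swap_apply] at hd
      have := ih (Polynomial.Bivariate.swap g) (swap_ne_zero hg0) (fun i => swap_mem _ _ _ (hg i))
      rw [Polynomial.Bivariate.swap_swap_apply] at this
      omega
    omega

end affine

section transfer

local notation "PX" => Polynomial.X
local notation "PC" => Polynomial.C

variable {k : Type*} [Field k]

theorem weight_w4 (e : Fin 4 →₀ ℕ) : Finsupp.weight w4 e = (e 0 + e 1, e 2 + e 3) := by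
  rw [Finsupp.weight_apply, Finsupp.sum_fintype _ _ (by simp), Fin.sum_univ_four]
  simp [w4]

/-- Dehomogenization. -/
def deh : MvPolynomial (Fin 4) k →ₐ[k] Polynomial (Polynomial k) :=
  aeval ![PX, 1, PC PX, 1]

theorem deh_monomial (e : Fin 4 →₀ ℕ) (c : k) :
    deh (monomial e c) = Polynomial.monomial (e 0) (Polynomial.monomial (e 2) c) := by
  rw [deh, aeval_monomial, Finsupp.prod_fintype _ _ (by simp), Fin.prod_univ_four]
  simp only [← Polynomial.C_mul_X_pow_eq_monomial, map_mul, map_pow,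
    Polynomial.coe_algebraMap_eq_CC]
  simp
  ring

theorem deh_eq (F : MvPolynomial (Fin 4) k) :
    deh F = ∑ e ∈ F.support, Polynomial.monomial (e 0) (Polynomial.monomial (e 2) (coeff e F)) := by
  conv_lhs => rw [F.as_sum]
  rw [map_sum]
  exact Finset.sum_congr rfl fun e _ => deh_monomial e _

theorem deh_degree {F : MvPolynomial (Fin 4) k} {d : ℕ × ℕ} (hF : F.IsWeightedHomogeneous w4 d) :
    (deh F).natDegree ≤ d.1 := by
  rw [deh_eq]
  refine Polynomial.natDegree_sum_le_of_forall_le _ _ fun e he => ?_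
  have := hF (mem_support_iff.1 he)
  rw [weight_w4] at this
  refine (Polynomial.natDegree_monomial_le _).trans ?_
  rw [← this]
  simp

theorem deh_degree_swap {F : MvPolynomial (Fin 4) k} {d : ℕ × ℕ}
    (hF : F.IsWeightedHomogeneous w4 d) :
    (Polynomial.Bivariate.swap (deh F)).natDegree ≤ d.2 := by
  rw [deh_eq, map_sum]
  refine Polynomial.natDegree_sum_le_of_forall_le _ _ fun e he => ?_
  have := hF (mem_support_iff.1 he)
  rw [weight_w4] at this
  rw [Polynomial.Bivariate.swap_monomial_monomial]
  refine (Polynomial.natDegree_monomial_le _).trans ?_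
  rw [← this]
  simp

theorem deh_ne_zero {F : MvPolynomial (Fin 4) k} {d : ℕ × ℕ}
    (hF : F.IsWeightedHomogeneous w4 d) (h0 : F ≠ 0) : deh F ≠ 0 := by
  obtain ⟨e, he⟩ := MvPolynomial.ne_zero_iff.1 h0
  intro h
  have h1 := congrArg (fun p => (Polynomial.coeff p (e 0)).coeff (e 2)) h
  simp only [deh_eq, Polynomial.finsetSum_coeff, Polynomial.coeff_zero] at h1
  rw [Finset.sum_eq_single e] at h1
  · simp only [Polynomial.coeff_monomial, if_true] at h1
    exact he h1
  · intro b hb hbe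
    have w1 := hF (mem_support_iff.1 hb)
    have w2 := hF he
    rw [weight_w4] at w1 w2
    rw [← w2, Prod.mk.injEq] at w1
    simp only [Polynomial.coeff_monomial]
    split_ifs with h3
    · simp only [Polynomial.coeff_monomial]
      split_ifs with h4
      · exfalso
        apply hbe
        ext i
        fin_cases i <;> simp <;> omega
      · rfl
    · simp
  · intro h
    simp [notMem_support_iff.1 h]

theorem deh_mem (p : (k × k) × (k × k)) (ha : p.1.2 ≠ 0) (hb : p.2.2 ≠ 0) (m : ℕ)
    {F : MvPolynomial (Fin 4) k} (hF : F ∈ pointIdeal k p ^ m) :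
    deh F ∈ affIdeal (p.1.1 / p.1.2) (p.2.1 / p.2.2) ^ m := by
  have h : pointIdeal k p ≤ Ideal.comap (deh (k := k)).toRingHom
      (affIdeal (p.1.1 / p.1.2) (p.2.1 / p.2.2)) := by
    rw [pointIdeal, Ideal.span_le]
    rintro x (rfl | rfl)
    · rw [SetLike.mem_coe, Ideal.mem_comap]
      have e : (deh (k := k)).toRingHom (C p.1.2 * X 0 - C p.1.1 * X 1)
          = PC (PC p.1.2) * (PX - PC (PC (p.1.1 / p.1.2))) := by
        rw [mul_sub, ← map_mul, ← map_mul, mul_div_cancel₀ _ ha]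
        simp [deh]
      rw [e]
      exact Ideal.mul_mem_left _ _ (Ideal.subset_span (by simp))
    · rw [SetLike.mem_coe, Ideal.mem_comap]
      have e : (deh (k := k)).toRingHom (C p.2.2 * X 2 - C p.2.1 * X 3)
          = PC (PC p.2.2) * PC (PX - PC (p.2.1 / p.2.2)) := by
        rw [map_sub (PC), mul_sub, ← map_mul (PC) (PC p.2.2) (PC _), ← map_mul (PC) p.2.2,
          mul_div_cancel₀ _ hb]
        simp [deh]
      rw [e]
      exact Ideal.mul_mem_left _ _ (Ideal.subset_span (by simp))
  exact ((Ideal.pow_right_mono h m).trans (Ideal.le_comap_pow _ m)) hF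

set_option maxHeartbeats 1000000 in
theorem exists_form (Z : Fin 5 → (k × k) × (k × k)) (ha : ∀ i, (Z i).1.2 ≠ 0)
    (hb : ∀ i, (Z i).2.2 ≠ 0) : ∃ F : MvPolynomial (Fin 4) k, F ≠ 0 ∧
      F.IsWeightedHomogeneous w4 (1, 2) ∧ ∀ i, F ∈ pointIdeal k (Z i) := by
  obtain ⟨c, hc0, hc⟩ := exists_coeffs (fun i => (Z i).1.1 / (Z i).1.2)
    (fun i => (Z i).2.1 / (Z i).2.2)
  refine ⟨(C (c 0) * (X 3 ^ 2 * X 0) + C (c 1) * (X 2 * X 3 * X 0) + C (c 2) * (X 2 ^ 2 * X 0)) +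
    (C (c 3) * (X 3 ^ 2 * X 1) + C (c 4) * (X 2 * X 3 * X 1) + C (c 5) * (X 2 ^ 2 * X 1)),
    ?_, ?_, ?_⟩
  · intro h0
    have h1 := congrArg deh h0
    have e : ∀ c : k, algebraMap k (Polynomial (Polynomial k)) c = PC (PC c) := fun _ => rfl
    have h2 : PC (PC (c 2) * PX ^ 2 + PC (c 1) * PX + PC (c 0)) * PX
        + PC (PC (c 5) * PX ^ 2 + PC (c 4) * PX + PC (c 3)) = 0 := by
      rw [map_zero] at h1
      rw [← h1]
      simp only [deh, map_add, map_mul, map_pow, aeval_X, aeval_C, e, Matrix.cons_val]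
      ring
    have hA : PC (c 2) * PX ^ 2 + PC (c 1) * PX + PC (c 0) = 0 := by
      have := congrArg (fun p => Polynomial.coeff p 1) h2
      simpa only [Polynomial.coeff_add, Polynomial.coeff_C_mul, Polynomial.coeff_X_one,
        mul_one, Polynomial.coeff_C_succ, add_zero, Polynomial.coeff_zero] using this
    have hB : PC (c 5) * PX ^ 2 + PC (c 4) * PX + PC (c 3) = 0 := by
      have := congrArg (fun p => Polynomial.coeff p 0) h2
      simpa only [Polynomial.coeff_add, Polynomial.mul_coeff_zero,
        Polynomial.coeff_X_zero, mul_zero, zero_add, Polynomial.coeff_C_zero,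
        Polynomial.coeff_zero] using this
    have hq : ∀ a b d : k, PC a * PX ^ 2 + PC b * PX + PC d = 0 → a = 0 ∧ b = 0 ∧ d = 0 := by
      intro a b d h
      have h0 := congrArg (fun p => Polynomial.coeff p 0) h
      have h1 := congrArg (fun p => Polynomial.coeff p 1) h
      have h2 := congrArg (fun p => Polynomial.coeff p 2) h
      simp [Polynomial.coeff_X, Polynomial.coeff_C] at h0 h1 h2
      exact ⟨h2, h1, h0⟩
    obtain ⟨c2, c1, c0⟩ := hq _ _ _ hA
    obtain ⟨c5, c4, c3⟩ := hq _ _ _ hB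
    apply hc0
    ext i
    clear h0 h1 h2 hA hB hq
    fin_cases i
    exacts [c0, c1, c2, c3, c4, c5]
  · have hX : ∀ i, IsWeightedHomogeneous w4 (X i : MvPolynomial (Fin 4) k) (w4 i) :=
      fun i => isWeightedHomogeneous_X k w4 i
    have h33 : ∀ j, IsWeightedHomogeneous w4 (X 3 ^ 2 * X j : MvPolynomial (Fin 4) k)
      (2 • w4 3 + w4 j) := fun j => ((hX 3).pow 2).mul (hX j)
    have h22 : ∀ j, IsWeightedHomogeneous w4 (X 2 ^ 2 * X j : MvPolynomial (Fin 4) k)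
      (2 • w4 2 + w4 j) := fun j => ((hX 2).pow 2).mul (hX j)
    have h23 : ∀ j, IsWeightedHomogeneous w4 (X 2 * X 3 * X j : MvPolynomial (Fin 4) k)
      (w4 2 + w4 3 + w4 j) := fun j => ((hX 2).mul (hX 3)).mul (hX j)
    exact ((((h33 0).C_mul _).add ((h23 0).C_mul _)).add ((h22 0).C_mul _)).add
      ((((h33 1).C_mul _).add ((h23 1).C_mul _)).add ((h22 1).C_mul _))
  · intro i
    rw [← Ideal.Quotient.eq_zero_iff_mem]
    set q := Ideal.Quotient.mk (pointIdeal k (Z i))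
    have hx : q (X 0) = q (C ((Z i).1.1 / (Z i).1.2)) * q (X 1) := by
      rw [← map_mul, ← sub_eq_zero, ← map_sub, Ideal.Quotient.eq_zero_iff_mem]
      have e : (X 0 - C ((Z i).1.1 / (Z i).1.2) * X 1 : MvPolynomial (Fin 4) k)
          = C ((Z i).1.2)⁻¹ * (C (Z i).1.2 * X 0 - C (Z i).1.1 * X 1) := by
        rw [mul_sub, ← mul_assoc, ← mul_assoc, ← map_mul, ← map_mul, inv_mul_cancel₀ (ha i),
          div_eq_inv_mul]
        simp
      rw [e]
      exact Ideal.mul_mem_left _ _ (Ideal.subset_span (by simp))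
    have hy : q (X 2) = q (C ((Z i).2.1 / (Z i).2.2)) * q (X 3) := by
      rw [← map_mul, ← sub_eq_zero, ← map_sub, Ideal.Quotient.eq_zero_iff_mem]
      have e : (X 2 - C ((Z i).2.1 / (Z i).2.2) * X 3 : MvPolynomial (Fin 4) k)
          = C ((Z i).2.2)⁻¹ * (C (Z i).2.2 * X 2 - C (Z i).2.1 * X 3) := by
        rw [mul_sub, ← mul_assoc, ← mul_assoc, ← map_mul, ← map_mul, inv_mul_cancel₀ (hb i),
          div_eq_inv_mul]
        simp
      rw [e]
      exact Ideal.mul_mem_left _ _ (Ideal.subset_span (by simp))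
    have h := congrArg (fun t => q (C t)) (hc i)
    simp only [map_add, map_mul, map_pow, map_zero] at h ⊢
    rw [hx, hy]
    linear_combination (q (X 1) * q (X 3) ^ 2) * h

theorem alpha_eq [IsAlgClosed k] (Z : Fin 5 → (k × k) × (k × k)) (ha : ∀ i, (Z i).1.2 ≠ 0)
    (hb : ∀ i, (Z i).2.2 ≠ 0)
    (hα : Function.Injective (fun i => (Z i).1.1 / (Z i).1.2))
    (hβ : Function.Injective (fun i => (Z i).2.1 / (Z i).2.2))
    (hN : NoFour (fun i => (Z i).1.1 / (Z i).1.2) (fun i => (Z i).2.1 / (Z i).2.2)) (m : ℕ) :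
    alpha k (symbolicPower k Z m) = 3 * m := by
  obtain ⟨F, hF0, hF, hFZ⟩ := exists_form Z ha hb
  have hmem : 3 * m ∈ {t | ∃ F ∈ symbolicPower k Z m, F ≠ 0 ∧ ∃ d : ℕ × ℕ,
      d.1 + d.2 = t ∧ F.IsWeightedHomogeneous w4 d} := by
    refine ⟨F ^ m, ?_, pow_ne_zero _ hF0, m • (1, 2), ?_, hF.pow m⟩
    · rw [symbolicPower, Ideal.mem_iInf]
      exact fun i => Ideal.pow_mem_pow (hFZ i) m
    · simp; ring
  apply le_antisymm
  · exact Nat.sInf_le hmem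
  · refine le_csInf ⟨_, hmem⟩ ?_
    rintro t ⟨H, hH, hH0, d, rfl, hd⟩
    rw [symbolicPower, Ideal.mem_iInf] at hH
    have := affine_bound _ _ hα hβ hN m (deh H) (deh_ne_zero hd hH0)
      (fun i => deh_mem (Z i) (ha i) (hb i) m (hH i))
    have h1 := deh_degree hd
    have h2 := deh_degree_swap hd
    omega

/-- The pairwise determinants. -/
def pairForm (u v : Fin 4) (p : Fin 5 × Fin 5) : MvPolynomial (Fin 5 × Fin 4) k :=
  X (p.1, u) * X (p.2, v) - X (p.1, v) * X (p.2, u)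

/-- The matrix of values of the `(1,1)` monomials at all points but the `i`-th. -/
def fourMat (i : Fin 5) : Matrix (Fin 4) (Fin 4) (MvPolynomial (Fin 5 × Fin 4) k) :=
  Matrix.of fun r c => X (i.succAbove r, ![1, 0, 1, 0] c) * X (i.succAbove r, ![3, 3, 2, 2] c)

/-- The form defining the open set. -/
def bigForm : MvPolynomial (Fin 5 × Fin 4) k :=
  (∏ i, X (i, 1)) * (∏ i, X (i, 3)) * (∏ p ∈ Finset.univ.offDiag, pairForm 0 1 p) *
    (∏ p ∈ Finset.univ.offDiag, pairForm 2 3 p) * ∏ i, (fourMat i).det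

theorem pairForm_hom (u v : Fin 4) (h : w4 u = w4 v) (p : Fin 5 × Fin 5) :
    IsWeightedHomogeneous (wProd 5) (pairForm (k := k) u v p)
      (Pi.single p.1 (w4 u) + Pi.single p.2 (w4 u)) := by
  apply IsWeightedHomogeneous.sub
  · have := (isWeightedHomogeneous_X k (wProd 5) (p.1, u)).mul
      (isWeightedHomogeneous_X k (wProd 5) (p.2, v))
    simpa only [wProd, ← h] using this
  · have := (isWeightedHomogeneous_X k (wProd 5) (p.1, v)).mul
      (isWeightedHomogeneous_X k (wProd 5) (p.2, u))
    simpa only [wProd, ← h] using this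

theorem fourMat_hom (i : Fin 5) :
    IsWeightedHomogeneous (wProd 5) (fourMat (k := k) i).det
      (∑ r : Fin 4, Pi.single (i.succAbove r) (1, 1)) := by
  have hent : ∀ r c, IsWeightedHomogeneous (wProd 5) (fourMat (k := k) i r c)
      (Pi.single (i.succAbove r) (1, 1)) := by
    intro r c
    have := (isWeightedHomogeneous_X k (wProd 5) (i.succAbove r, ![1, 0, 1, 0] c)).mul
      (isWeightedHomogeneous_X k (wProd 5) (i.succAbove r, ![3, 3, 2, 2] c))
    have e : w4 (![1, 0, 1, 0] c) + w4 (![3, 3, 2, 2] c) = (1, 1) := by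
      fin_cases c <;> rfl
    simp only [wProd, ← Pi.single_add, e] at this
    exact this
  rw [Matrix.det_apply']
  apply IsWeightedHomogeneous.sum
  intro σ _
  have h1 := IsWeightedHomogeneous.prod (w := wProd 5) Finset.univ
    (fun r => fourMat (k := k) i (σ r) r) _ (fun r _ => hent (σ r) r)
  rw [Equiv.sum_comp σ (fun r => (Pi.single (i.succAbove r) (1, 1) : Fin 5 → ℕ × ℕ))] at h1
  have h2 := h1.C_mul ((Equiv.Perm.sign σ : ℤ) : k)
  simpa using h2

theorem bigForm_hom : ∃ d, IsWeightedHomogeneous (wProd 5) (bigForm (k := k)) d :=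
  ⟨_, ((((IsWeightedHomogeneous.prod _ _ _ fun _ _ => isWeightedHomogeneous_X k _ _).mul
    (IsWeightedHomogeneous.prod _ _ _ fun _ _ => isWeightedHomogeneous_X k _ _)).mul
    (IsWeightedHomogeneous.prod _ _ _ fun p _ => pairForm_hom 0 1 rfl p)).mul
    (IsWeightedHomogeneous.prod _ _ _ fun p _ => pairForm_hom 2 3 rfl p)).mul
    (IsWeightedHomogeneous.prod _ _ _ fun i _ => fourMat_hom i)⟩

theorem eval_fourMat (Z : Fin 5 → (k × k) × (k × k)) (i : Fin 5) :
    eval (coordsOf k Z) (fourMat i).det = (Matrix.of fun r =>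
      ![(Z (i.succAbove r)).1.2 * (Z (i.succAbove r)).2.2,
        (Z (i.succAbove r)).1.1 * (Z (i.succAbove r)).2.2,
        (Z (i.succAbove r)).1.2 * (Z (i.succAbove r)).2.1,
        (Z (i.succAbove r)).1.1 * (Z (i.succAbove r)).2.1] : Matrix (Fin 4) (Fin 4) k).det := by
  rw [RingHom.map_det]
  congr 1
  ext r c
  fin_cases c <;> simp [fourMat, coordsOf]

theorem eval_bigForm (Z : Fin 5 → (k × k) × (k × k)) :
    eval (coordsOf k Z) bigForm ≠ 0 ↔
      (∀ i, (Z i).1.2 ≠ 0) ∧ (∀ i, (Z i).2.2 ≠ 0) ∧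
      (∀ i j, i ≠ j → (Z i).1.1 * (Z j).1.2 - (Z i).1.2 * (Z j).1.1 ≠ 0) ∧
      (∀ i j, i ≠ j → (Z i).2.1 * (Z j).2.2 - (Z i).2.2 * (Z j).2.1 ≠ 0) ∧
      ∀ i, eval (coordsOf k Z) (fourMat i).det ≠ 0 := by
  simp only [bigForm, map_mul, map_prod, mul_ne_zero_iff, Finset.prod_ne_zero_iff, and_assoc,
    Finset.mem_univ, true_imp_iff, Finset.mem_offDiag, Prod.forall, pairForm, map_sub, eval_X,
    true_and]
  rfl

theorem exists_config [IsAlgClosed k] : ∃ Z : Fin 5 → (k × k) × (k × k),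
    eval (coordsOf k Z) (bigForm (k := k)) ≠ 0 := by
  have : Infinite k := IsAlgClosed.instInfinite
  let e : Fin 5 → k := fun i => Infinite.natEmbedding k i
  have he : Function.Injective e := fun i j h =>
    Fin.ext ((Infinite.natEmbedding k).injective h)
  choose t ht using fun i => IsAlgClosed.exists_pow_nat_eq (e i) (n := 2) (by norm_num)
  have htinj : Function.Injective t := fun i j h => he (by rw [← ht i, ← ht j, h])
  refine ⟨fun i => ((t i, 1), (e i, 1)), (eval_bigForm _).2 ⟨?_, ?_, ?_, ?_, ?_⟩⟩
  · simp
  · simp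
  · intro i j hij
    simpa [sub_ne_zero] using htinj.ne hij
  · intro i j hij
    simpa [sub_ne_zero] using he.ne hij
  · intro i
    rw [eval_fourMat]
    have := Matrix.det_vandermonde_ne_zero_iff.2 (htinj.comp (Fin.succAbove_right_injective (p := i)))
    convert this using 2
    ext r c
    fin_cases c <;> simp [Matrix.vandermonde, ← ht]
    ring

theorem noFour_of (Z : Fin 5 → (k × k) × (k × k)) (ha : ∀ i, (Z i).1.2 ≠ 0)
    (hb : ∀ i, (Z i).2.2 ≠ 0) (h : ∀ i, eval (coordsOf k Z) (fourMat i).det ≠ 0) :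
    NoFour (fun i => (Z i).1.1 / (Z i).1.2) (fun i => (Z i).2.1 / (Z i).2.2) := by
  intro i p q r u hj
  have hi := h i
  rw [eval_fourMat] at hi
  have := Matrix.eq_zero_of_mulVec_eq_zero hi (v := ![p, q, r, u]) (by
    ext s
    have h1 := hj (i.succAbove s) (Fin.succAbove_ne i s)
    have h2 := ha (i.succAbove s)
    have h3 := hb (i.succAbove s)
    simp only [Matrix.mulVec, dotProduct, Fin.sum_univ_four, Matrix.of_apply]
    simp
    field_simp at h1
    linear_combination h1)
  refine ⟨congrFun this 0, congrFun this 1, congrFun this 2, congrFun this 3⟩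

end transfer

/-- For `5` general points of `P^1 × P^1`, `γ(I) = 3`. -/
theorem gamma_general_points_5 {k : Type*} [Field k] [IsAlgClosed k] :
    GeneralPosition k 5 (fun Z =>
      Filter.Tendsto
        (fun m : ℕ => (alpha k (symbolicPower k Z m) : ℝ) / m)
        Filter.atTop (nhds (3 : ℝ))) := by
  classical
  obtain ⟨d, hd⟩ := bigForm_hom (k := k)
  obtain ⟨Z₀, hZ₀⟩ := exists_config (k := k)
  refine ⟨bigForm, d, hd, ⟨Z₀, ?_, hZ₀⟩, ?_⟩
  · obtain ⟨ha, hb, -⟩ := (eval_bigForm Z₀).1 hZ₀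
    exact fun i => ⟨fun h => ha i (by rw [h]; rfl), fun h => hb i (by rw [h]; rfl)⟩
  · intro Z _ _ hG
    obtain ⟨ha, hb, hx, hy, hdet⟩ := (eval_bigForm Z).1 hG
    have hα : Function.Injective (fun i => (Z i).1.1 / (Z i).1.2) := by
      intro i j hij
      by_contra hne
      apply hx i j hne
      have h := (div_eq_div_iff (ha i) (ha j)).1 hij
      linear_combination h
    have hβ : Function.Injective (fun i => (Z i).2.1 / (Z i).2.2) := by
      intro i j hij
      by_contra hne
      apply hy i j hne
      have h := (div_eq_div_iff (hb i) (hb j)).1 hij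
      linear_combination h
    have hN := noFour_of Z ha hb hdet
    refine tendsto_const_nhds.congr' ?_
    filter_upwards [Filter.eventually_ge_atTop 1] with m hm
    rw [alpha_eq Z ha hb hα hβ hN m]
    have : (m : ℝ) ≠ 0 := by positivity
    push_cast
    field_simp
end
end

section
/- For 6 general points of P^1 x P^1, the ideal I of the points satisfies γ(I) = 24/7; that is, there is a nonempty Zariski-open subset U of (P^1 x P^1)^6 such that for every 6-tuple of pairwise distinct points lying in U, with I the ideal of these points, α(I^(m))/m tends to 24/7 as m → ∞. -/
open MvPolynomial

noncomputable section

variable (k : Type*) [Field k]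

namespace Gam

section helpers

variable {k : Type*} [Field k]

/-- The linear form in `x` vanishing at `u`. -/
def lx (u : k × k) : MvPolynomial (Fin 4) k := C u.2 * X 0 - C u.1 * X 1

/-- The linear form in `y` vanishing at `v`. -/
def ly (v : k × k) : MvPolynomial (Fin 4) k := C v.2 * X 2 - C v.1 * X 3

/-- The bracket of two vectors. -/
def br (u v : k × k) : k := u.1 * v.2 - u.2 * v.1

theorem pointIdeal_eq (p : (k × k) × (k × k)) :
    pointIdeal k p = Ideal.span {lx p.1, ly p.2} := rfl

theorem lx_mem (p : (k × k) × (k × k)) : lx p.1 ∈ pointIdeal k p :=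
  Ideal.subset_span (by simp [lx])

theorem ly_mem (p : (k × k) × (k × k)) : ly p.2 ∈ pointIdeal k p :=
  Ideal.subset_span (by simp [ly])

theorem exists_dual (u : k × k) (hu : u ≠ 0) : ∃ s : k × k, br u s = 1 := by
  by_cases h : u.1 = 0
  · have h2 : u.2 ≠ 0 := fun h2 => hu (Prod.ext h h2)
    exact ⟨(-(u.2)⁻¹, 0), by simp [br, h2]⟩
  · exact ⟨(0, (u.1)⁻¹), by simp [br, h]⟩

theorem order_hom (p : (k × k) × (k × k)) (hp : IsPtRep k p) :
    ∃ θ : MvPolynomial (Fin 4) k →+* Polynomial (MvPolynomial (Fin 4) k),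
      ∀ F m, F ∈ pointIdeal k p ^ m ↔ Polynomial.X ^ m ∣ θ F := by
  obtain ⟨u, v⟩ := p
  obtain ⟨hu, hv⟩ := hp
  obtain ⟨s, hs⟩ := exists_dual u hu
  obtain ⟨t, ht⟩ := exists_dual v hv
  simp only [br] at hs ht
  let θ : MvPolynomial (Fin 4) k →+* Polynomial (MvPolynomial (Fin 4) k) :=
    eval₂Hom (Polynomial.C.comp C)
      ![Polynomial.C (lx s * C u.1) - Polynomial.C (lx u * C s.1) * Polynomial.X,
        Polynomial.C (lx s * C u.2) - Polynomial.C (lx u * C s.2) * Polynomial.X,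
        Polynomial.C (ly t * C v.1) - Polynomial.C (ly v * C t.1) * Polynomial.X,
        Polynomial.C (ly t * C v.2) - Polynomial.C (ly v * C t.2) * Polynomial.X]
  have hsC : (C u.1 * C s.2 - C u.2 * C s.1 : MvPolynomial (Fin 4) k) = 1 := by
    rw [← C_mul, ← C_mul, ← C_sub, hs, C_1]
  have htC : (C v.1 * C t.2 - C v.2 * C t.1 : MvPolynomial (Fin 4) k) = 1 := by
    rw [← C_mul, ← C_mul, ← C_sub, ht, C_1]
  have hθlx : θ (lx u) = Polynomial.X * Polynomial.C (lx u) := by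
    have : θ (lx u) = Polynomial.X * Polynomial.C (lx u *
        (C u.1 * C s.2 - C u.2 * C s.1)) := by
      conv_lhs => rw [lx]
      simp only [θ, map_sub, map_mul, coe_eval₂Hom, eval₂_C, eval₂_X, RingHom.comp_apply,
        Matrix.cons_val_zero, Matrix.cons_val_one]
      ring
    rw [this, hsC, mul_one]
  have hθly : θ (ly v) = Polynomial.X * Polynomial.C (ly v) := by
    have : θ (ly v) = Polynomial.X * Polynomial.C (ly v *
        (C v.1 * C t.2 - C v.2 * C t.1)) := by
      conv_lhs => rw [ly]
      simp only [θ, map_sub, map_mul, coe_eval₂Hom, eval₂_C, eval₂_X, RingHom.comp_apply,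
        Matrix.cons_val]
      ring
    rw [this, htC, mul_one]
  have hrees : ∀ F, θ F ∈ reesAlgebra (pointIdeal k (u, v)) := by
    have hC : ∀ q, Polynomial.C q ∈ reesAlgebra (pointIdeal k (u, v)) := fun q =>
      (reesAlgebra (pointIdeal k (u, v))).algebraMap_mem q
    have hX : ∀ q ∈ pointIdeal k (u, v), Polynomial.C q * Polynomial.X ∈
        reesAlgebra (pointIdeal k (u, v)) := by
      intro q hq
      rw [Polynomial.C_mul_X_eq_monomial]
      exact reesAlgebra.monomial_mem.2 (by simpa using hq)
    intro F
    induction F using MvPolynomial.induction_on with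
    | C a => simpa [θ] using hC _
    | add p q hp hq => rw [map_add]; exact add_mem hp hq
    | mul_X p i hp =>
      rw [map_mul]
      refine mul_mem hp ?_
      have h1 := lx_mem (k := k) (u, v)
      have h2 := ly_mem (k := k) (u, v)
      fin_cases i <;> simp only [θ, coe_eval₂Hom, eval₂_X] <;>
        refine sub_mem (hC _) (hX _ (Ideal.mul_mem_right _ _ ?_)) <;> assumption
  have hone : ∀ F, (θ F).eval 1 = F := by
    intro F
    have : (Polynomial.evalRingHom (1 : MvPolynomial (Fin 4) k)).comp θ = RingHom.id _ := by
      apply MvPolynomial.ringHom_ext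
      · intro r; simp [θ]
      · intro i
        fin_cases i
        · simp [θ, lx]; linear_combination (X 0) * hsC
        · simp [θ, lx]; linear_combination (X 1) * hsC
        · simp [θ, ly]; linear_combination (X 2) * htC
        · simp [θ, ly]; linear_combination (X 3) * htC
    exact congrArg (fun f => f F) this
  refine ⟨θ, fun F m => ⟨fun h => ?_, fun h => ?_⟩⟩
  · have h1 : Ideal.map θ (pointIdeal k (u, v)) ≤ Ideal.span {Polynomial.X} := by
      rw [pointIdeal_eq, Ideal.map_span, Ideal.span_le]
      rintro _ ⟨q, hq, rfl⟩
      rcases hq with rfl | rfl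
      · exact Ideal.mem_span_singleton.2 ⟨_, hθlx⟩
      · exact Ideal.mem_span_singleton.2 ⟨_, hθly⟩
    have h2 := Ideal.mem_map_of_mem θ h
    rw [Ideal.map_pow] at h2
    have h3 := Ideal.pow_right_mono h1 m h2
    rwa [Ideal.span_singleton_pow, Ideal.mem_span_singleton] at h3
  · rw [← hone F, Polynomial.eval_eq_sum_range]
    refine Ideal.sum_mem _ fun i _ => ?_
    rw [one_pow, mul_one]
    by_cases hi : i < m
    · rw [Polynomial.X_pow_dvd_iff.1 h i hi]; exact zero_mem _
    · exact Ideal.pow_le_pow_right (not_lt.1 hi) ((mem_reesAlgebra_iff _ _).1 (hrees F) i)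

theorem colon (p : (k × k) × (k × k)) (hp : IsPtRep k p) (G F : MvPolynomial (Fin 4) k) (m : ℕ)
    (hG : G ∉ pointIdeal k p) (h : G * F ∈ pointIdeal k p ^ m) : F ∈ pointIdeal k p ^ m := by
  obtain ⟨θ, hθ⟩ := order_hom p hp
  rw [hθ] at h ⊢
  have hG' : ¬ Polynomial.X ∣ θ G := by
    intro h'
    apply hG
    have := (hθ G 1).2 (by simpa using h')
    simpa using this
  rw [map_mul] at h
  exact Polynomial.prime_X.pow_dvd_of_dvd_mul_left _ hG' h

theorem colon_pow (p : (k × k) × (k × k)) (hp : IsPtRep k p) (G F : MvPolynomial (Fin 4) k)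
    (m n : ℕ)
    (hG : G ∉ pointIdeal k p) (h : G ^ n * F ∈ pointIdeal k p ^ m) : F ∈ pointIdeal k p ^ m := by
  induction n with
  | zero => simpa using h
  | succ n ih => exact ih (colon p hp G _ m hG (by rwa [← mul_assoc, ← pow_succ']))

theorem colon' (p : (k × k) × (k × k)) (hp : IsPtRep k p) (G F : MvPolynomial (Fin 4) k) (m : ℕ)
    (hG1 : G ∈ pointIdeal k p)
    (hG : G ∉ pointIdeal k p ^ 2) (h : G * F ∈ pointIdeal k p ^ m) :
    F ∈ pointIdeal k p ^ (m - 1) := by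
  obtain ⟨θ, hθ⟩ := order_hom p hp
  rcases m with _ | m
  · simp
  rw [hθ] at h hG ⊢
  have h1 := (hθ G 1).1 (by simpa using hG1)
  rw [pow_one] at h1
  obtain ⟨c, hc⟩ := h1
  have hG' : ¬ Polynomial.X ∣ c := by
    rintro ⟨e, rfl⟩
    apply hG
    exact ⟨e, by rw [hc]; ring⟩
  rw [map_mul, hc, pow_succ', mul_assoc] at h
  have h := (mul_dvd_mul_iff_left Polynomial.X_ne_zero).1 h
  exact Polynomial.prime_X.pow_dvd_of_dvd_mul_left _ hG' h

theorem colon'_pow (p : (k × k) × (k × k)) (hp : IsPtRep k p) (G F : MvPolynomial (Fin 4) k)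
    (m n : ℕ) (hG1 : G ∈ pointIdeal k p)
    (hG : G ∉ pointIdeal k p ^ 2) (h : G ^ n * F ∈ pointIdeal k p ^ m) :
    F ∈ pointIdeal k p ^ (m - n) := by
  induction n generalizing m with
  | zero => simpa using h
  | succ n ih =>
    have := ih (m - 1) (colon' p hp G _ m hG1 hG (by rwa [← mul_assoc, ← pow_succ']))
    rwa [Nat.sub_sub, add_comm] at this

/-- evaluation at a point -/
def evp (p : (k × k) × (k × k)) : MvPolynomial (Fin 4) k →+* k :=
  eval ![p.1.1, p.1.2, p.2.1, p.2.2]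

theorem evp_lx (p : (k × k) × (k × k)) (u : k × k) : evp p (lx u) = br p.1 u := by
  simp [evp, lx, br]; ring

theorem evp_ly (p : (k × k) × (k × k)) (u : k × k) : evp p (ly u) = br p.2 u := by
  simp [evp, ly, br]; ring

theorem br_self (u : k × k) : br u u = 0 := by simp [br]; ring

theorem evp_mem (p : (k × k) × (k × k)) (F) (h : F ∈ pointIdeal k p) : evp p F = 0 := by
  have : pointIdeal k p ≤ RingHom.ker (evp p) := by
    rw [pointIdeal_eq, Ideal.span_le]
    rintro _ (rfl | rfl)
    · simp [RingHom.mem_ker, evp_lx, br_self]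
    · simp [RingHom.mem_ker, evp_ly, br_self]
  exact this h

theorem lx_notMem (p : (k × k) × (k × k)) (u : k × k) (h : br p.1 u ≠ 0) :
    lx u ∉ pointIdeal k p := fun h' => h (by rw [← evp_lx, evp_mem p _ h'])

theorem lx_notMem_sq (p : (k × k) × (k × k)) (hp : IsPtRep k p) : lx p.1 ∉ pointIdeal k p ^ 2 := by
  intro h
  obtain ⟨u, v⟩ := p
  obtain ⟨s, hs⟩ := exists_dual u hp.1
  simp only [br] at hs
  -- move along the direction s
  let ψ : MvPolynomial (Fin 4) k →+* Polynomial k :=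
    eval₂Hom Polynomial.C ![Polynomial.C u.1 + Polynomial.C s.1 * Polynomial.X,
      Polynomial.C u.2 + Polynomial.C s.2 * Polynomial.X, Polynomial.C v.1, Polynomial.C v.2]
  have hsC : (Polynomial.C u.1 * Polynomial.C s.2 - Polynomial.C u.2 * Polynomial.C s.1
      : Polynomial k) = 1 := by
    rw [← Polynomial.C_mul, ← Polynomial.C_mul, ← Polynomial.C_sub, hs, Polynomial.C_1]
  have h1 : ψ (lx u) = - Polynomial.X := by
    simp [ψ, lx]
    linear_combination (-Polynomial.X) * hsC
  have h2 : ψ (ly v) = 0 := by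
    simp [ψ, ly]
    ring
  have h3 : Ideal.map ψ (pointIdeal k (u, v)) ≤ Ideal.span {Polynomial.X} := by
    rw [pointIdeal_eq, Ideal.map_span, Ideal.span_le]
    rintro _ ⟨q, hq, rfl⟩
    rcases hq with rfl | rfl
    · exact Ideal.mem_span_singleton.2 ⟨-1, by simp [h1]⟩
    · simp [h2]
  have h4 := Ideal.mem_map_of_mem ψ h
  rw [Ideal.map_pow] at h4
  have h5 := Ideal.pow_right_mono h3 2 h4
  rw [Ideal.span_singleton_pow, Ideal.mem_span_singleton, Polynomial.X_pow_dvd_iff] at h5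
  have := h5 1 (by norm_num)
  simp [h1] at this

theorem lx_ne_zero (u : k × k) (hu : u ≠ 0) : lx u ≠ 0 := by
  intro h
  obtain ⟨s, hs⟩ := exists_dual u hu
  have := evp_lx (s, s) u
  rw [h, map_zero] at this
  simp only [br] at this hs
  exact one_ne_zero (α := k) (by linear_combination -hs + this)

theorem lx_prime (u : k × k) (hu : u ≠ 0) : Prime (lx u) := by
  have h0 := lx_ne_zero u hu
  have hh : (lx u).IsHomogeneous 1 := by
    refine IsHomogeneous.sub ?_ ?_
    · simpa using (isHomogeneous_C (Fin 4) u.2).mul (isHomogeneous_X k (0 : Fin 4))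
    · simpa using (isHomogeneous_C (Fin 4) u.1).mul (isHomogeneous_X k (1 : Fin 4))
  refine (irreducible_of_totalDegree_eq_one (hh.totalDegree h0) ?_).prime
  intro x hx
  obtain ⟨d, hd⟩ := ne_zero_iff.1 h0
  refine isUnit_iff_ne_zero.2 ?_
  rintro rfl
  exact hd (zero_dvd_iff.1 (hx d))

theorem lx_hom (u : k × k) : (lx u).IsWeightedHomogeneous w4 (1, 0) := by
  refine IsWeightedHomogeneous.sub ?_ ?_
  · exact (isWeightedHomogeneous_X k w4 0).C_mul _
  · exact (isWeightedHomogeneous_X k w4 1).C_mul _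

theorem ly_hom (u : k × k) : (ly u).IsWeightedHomogeneous w4 (0, 1) := by
  refine IsWeightedHomogeneous.sub ?_ ?_
  · exact (isWeightedHomogeneous_X k w4 2).C_mul _
  · exact (isWeightedHomogeneous_X k w4 3).C_mul _

theorem hom_quot (l F : MvPolynomial (Fin 4) k) (e d : ℕ × ℕ) (hl0 : l ≠ 0) (hF0 : F ≠ 0)
    (hl : l.IsWeightedHomogeneous w4 e) (h : (l * F).IsWeightedHomogeneous w4 d) :
    ∃ d', F.IsWeightedHomogeneous w4 d' ∧ e + d' = d := by
  classical
  let _ := weightedGradedAlgebra k w4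
  have key : ∀ c, coeff c F ≠ 0 → e + Finsupp.weight w4 c = d := by
    intro c hc
    have h1 := DirectSum.coe_decompose_mul_add_of_left_mem
      (weightedHomogeneousSubmodule k w4) (b := F) (j := Finsupp.weight w4 c) hl
    have h2 : (DirectSum.decompose (weightedHomogeneousSubmodule k w4) F
        (Finsupp.weight w4 c) : MvPolynomial (Fin 4) k) ≠ 0 := by
      intro h0
      apply hc
      have := weightedDecomposition.decompose'_apply k w4 F (Finsupp.weight w4 c)
      have h3 : weightedHomogeneousComponent w4 (Finsupp.weight w4 c) F = 0 := by
        rw [← this]; exact h0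
      have h4 := coeff_weightedHomogeneousComponent (w := w4) (Finsupp.weight w4 c) F c
      rw [h3] at h4
      simpa using h4.symm
    by_contra hne
    rw [DirectSum.decompose_of_mem_ne _ h (Ne.symm hne)] at h1
    exact mul_ne_zero hl0 h2 h1.symm
  obtain ⟨c, hc⟩ := ne_zero_iff.1 hF0
  refine ⟨Finsupp.weight w4 c, fun c' hc' => ?_, key c hc⟩
  have := (key c' hc').trans (key c hc).symm
  exact add_left_cancel this

theorem weight_w4 (c : Fin 4 →₀ ℕ) : Finsupp.weight w4 c = (c 0 + c 1, c 2 + c 3) := by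
  rw [Finsupp.weight_apply, Finsupp.sum_fintype _ _ (by simp)]
  ext <;> simp [Fin.sum_univ_four, w4]

theorem hom_ind (P : MvPolynomial (Fin 4) k → Prop) (a b : ℕ) (h0 : P 0)
    (hadd : ∀ p q, P p → P q → P (p + q))
    (hm : ∀ c0 c1 c2 c3 r, c0 + c1 = a → c2 + c3 = b →
      P (C r * X 0 ^ c0 * X 1 ^ c1 * X 2 ^ c2 * X 3 ^ c3))
    (F : MvPolynomial (Fin 4) k) (hF : F.IsWeightedHomogeneous w4 (a, b)) : P F := by
  refine IsWeightedHomogeneous.induction_on (motive := fun p _ => P p) h0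
    (fun p q _ _ => hadd p q) ?_ hF
  intro c r hr
  rw [weight_w4, Prod.mk.injEq] at hr
  have := hm (c 0) (c 1) (c 2) (c 3) r hr.1 hr.2
  rw [monomial_eq, Finsupp.prod_fintype _ _ (by simp), Fin.prod_univ_four]
  simpa [mul_assoc] using this

theorem hom_scale {A : Type*} [CommRing A] (f g : MvPolynomial (Fin 4) k →+* A) (s t : A)
    (a b : ℕ) (hC : ∀ r, f (C r) = g (C r)) (h0 : f (X 0) = s * g (X 0)) (h1 : f (X 1) = s * g (X 1))
    (h2 : f (X 2) = t * g (X 2)) (h3 : f (X 3) = t * g (X 3))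
    (F : MvPolynomial (Fin 4) k) (hF : F.IsWeightedHomogeneous w4 (a, b)) :
    f F = s ^ a * t ^ b * g F := by
  refine hom_ind (fun F => f F = s ^ a * t ^ b * g F) a b (by simp) ?_ ?_ F hF
  · intro p q hp hq; rw [map_add, hp, hq, map_add]; ring
  · rintro c0 c1 c2 c3 r rfl rfl
    simp only [map_mul, map_pow, hC, h0, h1, h2, h3]
    ring

theorem hom_map (f : MvPolynomial (Fin 4) k →+* MvPolynomial (Fin 4) k) (d e : ℕ × ℕ)
    (a b : ℕ) (hC : ∀ r, f (C r) = C r) (h0 : (f (X 0)).IsWeightedHomogeneous w4 d)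
    (h1 : (f (X 1)).IsWeightedHomogeneous w4 d)
    (h2 : (f (X 2)).IsWeightedHomogeneous w4 e) (h3 : (f (X 3)).IsWeightedHomogeneous w4 e)
    (F : MvPolynomial (Fin 4) k) (hF : F.IsWeightedHomogeneous w4 (a, b)) :
    (f F).IsWeightedHomogeneous w4 (a • d + b • e) := by
  refine hom_ind (fun F => (f F).IsWeightedHomogeneous w4 (a • d + b • e)) a b ?_ ?_ ?_ F hF
  · rw [map_zero]; exact isWeightedHomogeneous_zero _ _ _
  · intro p q hp hq; rw [map_add]; exact hp.add hq
  · rintro c0 c1 c2 c3 r rfl rfl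
    simp only [map_mul, map_pow, hC]
    have := ((((h0.pow c0).C_mul r).mul (h1.pow c1)).mul (h2.pow c2)).mul (h3.pow c3)
    convert this using 1
    rw [add_smul, add_smul]; abel

theorem hom_mem (f : MvPolynomial (Fin 4) k →+* MvPolynomial (Fin 4) k)
    (I : Ideal (MvPolynomial (Fin 4) k)) (a b : ℕ) (h2 : f (X 2) ∈ I) (h3 : f (X 3) ∈ I)
    (F : MvPolynomial (Fin 4) k) (hF : F.IsWeightedHomogeneous w4 (a, b)) :
    f F ∈ I ^ b := by
  refine hom_ind (fun F => f F ∈ I ^ b) a b (by simp) ?_ ?_ F hF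
  · intro p q hp hq; rw [map_add]; exact add_mem hp hq
  · rintro c0 c1 c2 c3 r rfl rfl
    simp only [map_mul, map_pow]
    rw [pow_add, mul_assoc]
    exact Ideal.mul_mem_left _ _ (Ideal.mul_mem_mul (Ideal.pow_mem_pow h2 _) (Ideal.pow_mem_pow h3 _))

/-- The class `(p, q; n)` is nef with respect to `Z`. -/
def Nef (Z : Fin 6 → (k × k) × (k × k)) (p q : ℕ) (n : Fin 6 → ℕ) : Prop :=
  ∀ (F : MvPolynomial (Fin 4) k) (a b : ℕ) (m : Fin 6 → ℕ), F ≠ 0 →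
    F.IsWeightedHomogeneous w4 (a, b) → (∀ i, F ∈ pointIdeal k (Z i) ^ m i) →
    ∑ i, n i * m i ≤ p * b + q * a

/-- All coordinates are pairwise distinct. -/
def Good (Z : Fin 6 → (k × k) × (k × k)) : Prop :=
  ∀ i j, i ≠ j → br (Z i).1 (Z j).1 ≠ 0 ∧ br (Z i).2 (Z j).2 ≠ 0

/-- The elementary transformation of `Z` centered at the points `i` and `j`. -/
def T (i j : Fin 6) (Z : Fin 6 → (k × k) × (k × k)) : Fin 6 → (k × k) × (k × k) := fun l =>
  if l = i then ((Z i).1, (Z j).2) else if l = j then ((Z j).1, (Z i).2) else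
    ((Z l).1, (br (Z l).1 (Z i).1 * br (Z l).2 (Z j).2) • (Z i).2 +
      (br (Z l).1 (Z j).1 * br (Z l).2 (Z i).2) • (Z j).2)

theorem br_ne_left {u v : k × k} (h : br u v ≠ 0) : u ≠ 0 := by
  rintro rfl; simp [br] at h

theorem br_ne_right {u v : k × k} (h : br u v ≠ 0) : v ≠ 0 := by
  rintro rfl; simp [br] at h

theorem br_comm (u v : k × k) : br u v = - br v u := by simp [br]; ring

theorem Good.rep {Z : Fin 6 → (k × k) × (k × k)} (h : Good Z) (i : Fin 6) : IsPtRep k (Z i) := by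
  obtain ⟨j, hj⟩ := exists_ne i
  exact ⟨br_ne_right (h j i hj).1, br_ne_right (h j i hj).2⟩

theorem map_pow_mem {A B : Type*} [CommRing A] [CommRing B] (f : A →+* B) (S : Set A) (J : Ideal B)
    (h : ∀ x ∈ S, f x ∈ J) (F : A) (m : ℕ) (hF : F ∈ Ideal.span S ^ m) : f F ∈ J ^ m := by
  have h1 : Ideal.map f (Ideal.span S) ≤ J := by
    rw [Ideal.map_span, Ideal.span_le]
    rintro _ ⟨q, hq, rfl⟩
    exact h q hq
  have h2 := Ideal.mem_map_of_mem f hF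
  rw [Ideal.map_pow] at h2
  exact Ideal.pow_right_mono h1 m h2

/-- The ring map of an elementary transformation. -/
def Phi (u1 u2 v1 v2 : k × k) : MvPolynomial (Fin 4) k →+* MvPolynomial (Fin 4) k :=
  eval₂Hom C ![X 0, X 1, C v2.1 * (lx u1 * ly v1) + C v1.1 * (lx u2 * ly v2),
    C v2.2 * (lx u1 * ly v1) + C v1.2 * (lx u2 * ly v2)]

theorem Phi_C (u1 u2 v1 v2 : k × k) (r : k) : Phi u1 u2 v1 v2 (C r) = C r := by simp [Phi]
theorem Phi_0 (u1 u2 v1 v2 : k × k) : Phi u1 u2 v1 v2 (X 0) = X 0 := by simp [Phi]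
theorem Phi_1 (u1 u2 v1 v2 : k × k) : Phi u1 u2 v1 v2 (X 1) = X 1 := by simp [Phi]
theorem Phi_2 (u1 u2 v1 v2 : k × k) : Phi u1 u2 v1 v2 (X 2) =
    C v2.1 * (lx u1 * ly v1) + C v1.1 * (lx u2 * ly v2) := by simp [Phi]
theorem Phi_3 (u1 u2 v1 v2 : k × k) : Phi u1 u2 v1 v2 (X 3) =
    C v2.2 * (lx u1 * ly v1) + C v1.2 * (lx u2 * ly v2) := by simp [Phi]

theorem Phi_lx (u1 u2 v1 v2 u : k × k) : Phi u1 u2 v1 v2 (lx u) = lx u := by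
  simp only [lx, map_sub, map_mul, Phi_C, Phi_0, Phi_1]

theorem Phi_ly (u1 u2 v1 v2 v : k × k) : Phi u1 u2 v1 v2 (ly v) =
    C (br v2 v) * (lx u1 * ly v1) + C (br v1 v) * (lx u2 * ly v2) := by
  conv_lhs => rw [ly]
  simp only [map_sub, map_mul, Phi_C, Phi_2, Phi_3, br]
  ring

theorem lx_rel (u u1 u2 : k × k) : C (br u u1) * lx u2 - C (br u u2) * lx u1 =
    C (br u2 u1) * lx u := by
  simp only [lx, br, map_sub, map_mul]; ring

theorem ly_comb (s t : k) (v1 v2 : k × k) : ly (s • v1 + t • v2) = C s * ly v1 + C t * ly v2 := by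
  simp [ly]; ring

theorem Phi_ne_zero (u1 u2 v1 v2 : k × k) (hu1 : u1 ≠ 0) (hu2 : u2 ≠ 0) (hv : br v1 v2 ≠ 0)
    (F : MvPolynomial (Fin 4) k) (a b : ℕ) (hF : F.IsWeightedHomogeneous w4 (a, b))
    (h0 : F ≠ 0) : Phi u1 u2 v1 v2 F ≠ 0 := by
  intro h
  have key := hom_scale ((Phi u1 u2 v2 v1).comp (Phi u1 u2 v1 v2)) (RingHom.id _) 1
    (C (br v1 v2 ^ 2) * (lx u1 * lx u2)) a b ?_ ?_ ?_ ?_ ?_ F hF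
  · rw [RingHom.comp_apply, h, map_zero] at key
    have hb : (C (br v1 v2 ^ 2) : MvPolynomial (Fin 4) k) ≠ 0 := by
      simpa using hv
    refine absurd key.symm ?_
    simp [h0, lx_ne_zero, hu1, hu2, hv]
  · intro r; simp [Phi_C]
  · simp [Phi_0]
  · simp [Phi_1]
  · rw [RingHom.comp_apply, Phi_2]
    simp only [map_add, map_mul, Phi_C, Phi_lx, Phi_ly, RingHom.id_apply]
    simp only [ly, br, map_sub, map_mul, map_pow]
    ring
  · rw [RingHom.comp_apply, Phi_3]
    simp only [map_add, map_mul, Phi_C, Phi_lx, Phi_ly, RingHom.id_apply]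
    simp only [ly, br, map_sub, map_mul, map_pow]
    ring

theorem mul_C_mem {I : Ideal (MvPolynomial (Fin 4) k)} {c : k} (hc : c ≠ 0)
    {F : MvPolynomial (Fin 4) k} (h : C c * F ∈ I) : F ∈ I := by
  have := I.mul_mem_left (C c⁻¹) h
  rwa [← mul_assoc, ← C_mul, inv_mul_cancel₀ hc, C_1, one_mul] at this

theorem step (i j : Fin 6) (hij : i ≠ j) (Z : Fin 6 → (k × k) × (k × k)) (hZ : Good Z)
    (p q p' : ℕ) (n n' : Fin 6 → ℕ) (hp : p' + n i + n j = p + q) (hi : n' i + n i = q)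
    (hj : n' j + n j = q) (hl : ∀ l, l ≠ i → l ≠ j → n' l = n l)
    (h : Nef (T i j Z) p' q n') : Nef Z p q n := by
  intro F a b m hF0 hF hm
  set u1 := (Z i).1 with hu1
  set u2 := (Z j).1 with hu2
  set v1 := (Z i).2 with hv1
  set v2 := (Z j).2 with hv2
  have hbu : br u1 u2 ≠ 0 := (hZ i j hij).1
  have hbv : br v1 v2 ≠ 0 := (hZ i j hij).2
  have hbv' : br v2 v1 ≠ 0 := (hZ j i hij.symm).2
  have hu10 := br_ne_left hbu
  have hu20 := br_ne_right hbu
  have hv10 := br_ne_left hbv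
  have hv20 := br_ne_right hbv
  set H := Phi u1 u2 v1 v2 F with hH
  have hH0 : H ≠ 0 := Phi_ne_zero u1 u2 v1 v2 hu10 hu20 hbv F a b hF hF0
  have hHhom : H.IsWeightedHomogeneous w4 (a • (1, 0) + b • (1, 1)) := by
    refine hom_map _ _ _ a b (Phi_C _ _ _ _) ?_ ?_ ?_ ?_ F hF
    · rw [Phi_0]; exact isWeightedHomogeneous_X k w4 0
    · rw [Phi_1]; exact isWeightedHomogeneous_X k w4 1
    · rw [Phi_2]
      exact (((lx_hom _).mul (ly_hom _)).C_mul _).add (((lx_hom _).mul (ly_hom _)).C_mul _)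
    · rw [Phi_3]
      exact (((lx_hom _).mul (ly_hom _)).C_mul _).add (((lx_hom _).mul (ly_hom _)).C_mul _)
  -- divisibility
  have hd1 : lx u1 ^ m i ∣ H := by
    rw [← Ideal.mem_span_singleton, ← Ideal.span_singleton_pow]
    refine map_pow_mem _ {lx u1, ly v1} _ ?_ F _ (hm i)
    rintro _ (rfl | rfl)
    · rw [Phi_lx]; exact Ideal.mem_span_singleton_self _
    · rw [Phi_ly, br_self, C_0, zero_mul, add_zero]
      exact Ideal.mem_span_singleton.2 ⟨C (br v2 v1) * ly v1, by ring⟩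
  have hd2 : lx u2 ^ m j ∣ H := by
    rw [← Ideal.mem_span_singleton, ← Ideal.span_singleton_pow]
    refine map_pow_mem _ {lx u2, ly v2} _ ?_ F _ (hm j)
    rintro _ (rfl | rfl)
    · rw [Phi_lx]; exact Ideal.mem_span_singleton_self _
    · rw [Phi_ly, br_self, C_0, zero_mul, zero_add]
      exact Ideal.mem_span_singleton.2 ⟨C (br v1 v2) * ly v2, by ring⟩
  obtain ⟨H1, hH1⟩ := hd1
  have hnd : ¬ lx u2 ∣ lx u1 ^ m i := by
    intro h'
    obtain ⟨c, hc⟩ := (lx_prime u2 hu20).dvd_of_dvd_pow h'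
    have := congrArg (evp (u2, v2)) hc
    rw [map_mul, evp_lx, evp_lx, br_self, zero_mul] at this
    exact (hZ j i hij.symm).1 this
  rw [hH1] at hd2
  have hd3 : lx u2 ^ m j ∣ H1 := (lx_prime u2 hu20).pow_dvd_of_dvd_mul_left _ hnd hd2
  obtain ⟨F', hF'⟩ := hd3
  have hHF : H = lx u1 ^ m i * lx u2 ^ m j * F' := by rw [hH1, hF', mul_assoc]
  have hF'0 : F' ≠ 0 := by rintro rfl; exact hH0 (by simp [hHF])
  have hpowhom : (lx u1 ^ m i * lx u2 ^ m j).IsWeightedHomogeneous w4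
      (m i • (1, 0) + m j • (1, 0)) := ((lx_hom u1).pow _).mul ((lx_hom u2).pow _)
  obtain ⟨⟨a', b'⟩, hF'hom, hdeg⟩ := hom_quot _ F' _ _
    (mul_ne_zero (pow_ne_zero _ (lx_ne_zero _ hu10)) (pow_ne_zero _ (lx_ne_zero _ hu20))) hF'0
    hpowhom (hHF ▸ hHhom)
  have hdeg1 : m i + m j + a' = a + b := by simpa using congrArg Prod.fst hdeg
  have hdeg2 : b' = b := by simpa using congrArg Prod.snd hdeg
  subst hdeg2
  -- multiplicities
  have hmi : F' ∈ pointIdeal k (u1, v2) ^ (b' - m i) := by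
    have hr : IsPtRep k (u1, v2) := ⟨hu10, hv20⟩
    have h1 : H ∈ pointIdeal k (u1, v2) ^ b' := by
      refine hom_mem _ _ a b' ?_ ?_ F hF
      · rw [Phi_2]
        refine add_mem (Ideal.mul_mem_left _ _ (Ideal.mul_mem_right _ _ (lx_mem (u1, v2))))
          (Ideal.mul_mem_left _ _ (Ideal.mul_mem_left _ _ (ly_mem (u1, v2))))
      · rw [Phi_3]
        refine add_mem (Ideal.mul_mem_left _ _ (Ideal.mul_mem_right _ _ (lx_mem (u1, v2))))
          (Ideal.mul_mem_left _ _ (Ideal.mul_mem_left _ _ (ly_mem (u1, v2))))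
    rw [hHF, mul_comm (lx u1 ^ m i), mul_assoc] at h1
    exact colon'_pow _ hr _ _ _ _ (lx_mem (u1, v2)) (lx_notMem_sq _ hr)
      (colon_pow _ hr _ _ _ _ (lx_notMem _ _ hbu) h1)
  have hmj : F' ∈ pointIdeal k (u2, v1) ^ (b' - m j) := by
    have hr : IsPtRep k (u2, v1) := ⟨hu20, hv10⟩
    have h1 : H ∈ pointIdeal k (u2, v1) ^ b' := by
      refine hom_mem _ _ a b' ?_ ?_ F hF
      · rw [Phi_2]
        refine add_mem (Ideal.mul_mem_left _ _ (Ideal.mul_mem_left _ _ (ly_mem (u2, v1))))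
          (Ideal.mul_mem_left _ _ (Ideal.mul_mem_right _ _ (lx_mem (u2, v1))))
      · rw [Phi_3]
        refine add_mem (Ideal.mul_mem_left _ _ (Ideal.mul_mem_left _ _ (ly_mem (u2, v1))))
          (Ideal.mul_mem_left _ _ (Ideal.mul_mem_right _ _ (lx_mem (u2, v1))))
    rw [hHF, mul_assoc] at h1
    exact colon'_pow _ hr _ _ _ _ (lx_mem (u2, v1)) (lx_notMem_sq _ hr)
      (colon_pow _ hr _ _ _ _ (lx_notMem _ _ (hZ j i hij.symm).1) h1)
  have hml : ∀ l, l ≠ i → l ≠ j → F' ∈ pointIdeal k (T i j Z l) ^ m l := by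
    intro l hli hlj
    set w := (br (Z l).1 u1 * br (Z l).2 v2) • v1 + (br (Z l).1 u2 * br (Z l).2 v1) • v2 with hw
    have hT : T i j Z l = ((Z l).1, w) := by simp [T, hli, hlj, hw, hu1, hu2, hv1, hv2]
    have hw0 : br w v1 ≠ 0 := by
      have : br w v1 = br (Z l).1 u2 * br (Z l).2 v1 * br v2 v1 := by
        simp only [hw, br, Prod.fst_add, Prod.snd_add, Prod.smul_fst, Prod.smul_snd, smul_eq_mul]
        ring
      rw [this]
      exact mul_ne_zero (mul_ne_zero (hZ l j hlj).1 (hZ l i hli).2) hbv'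
    rw [hT]
    have hr : IsPtRep k ((Z l).1, w) := ⟨(hZ.rep l).1, br_ne_left hw0⟩
    have h1 : H ∈ pointIdeal k ((Z l).1, w) ^ m l := by
      refine map_pow_mem _ {lx (Z l).1, ly (Z l).2} _ ?_ F _ (hm l)
      rintro _ (rfl | rfl)
      · rw [Phi_lx]; exact lx_mem ((Z l).1, w)
      · rw [Phi_ly]
        refine mul_C_mem (hZ l i hli).1 ?_
        have e : C (br (Z l).1 (Z i).1) * (C (br v2 (Z l).2) * (lx u1 * ly v1) +
            C (br v1 (Z l).2) * (lx u2 * ly v2)) =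
            (- lx u1) * ly w + (- C (br (Z l).2 v1) * ly v2 * C (br u2 u1)) * lx (Z l).1 := by
          rw [mul_assoc _ (C (br u2 u1)), ← lx_rel, hw, ly_comb, br_comm v2, br_comm v1]
          simp only [map_mul, map_neg]
          ring
        rw [e]
        exact add_mem (Ideal.mul_mem_left _ _ (ly_mem ((Z l).1, w)))
          (Ideal.mul_mem_left _ _ (lx_mem ((Z l).1, w)))
    rw [hHF, mul_assoc] at h1
    exact colon_pow _ hr _ _ _ _ (lx_notMem _ _ (hZ l j hlj).1)
      (colon_pow _ hr _ _ _ _ (lx_notMem _ _ (hZ l i hli).1) h1)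
  -- conclusion
  let m' : Fin 6 → ℕ := fun l => if l = i then b' - m i else if l = j then b' - m j else m l
  have hfin := h F' a' b' m' hF'0 hF'hom (by
    intro l
    by_cases hli : l = i
    · subst hli; simpa [T, m'] using hmi
    · by_cases hlj : l = j
      · subst hlj; simpa [T, m', hli] using hmj
      · simpa [m', hli, hlj] using hml l hli hlj)
  have hjm : j ∈ (Finset.univ : Finset (Fin 6)).erase i := by simp [hij.symm]
  rw [← Finset.add_sum_erase _ _ (Finset.mem_univ i), ← Finset.add_sum_erase _ _ hjm] at hfin ⊢
  have hrest : ∑ l ∈ (Finset.univ.erase i).erase j, n' l * m' l =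
      ∑ l ∈ (Finset.univ.erase i).erase j, n l * m l := by
    refine Finset.sum_congr rfl fun l hl' => ?_
    simp only [Finset.mem_erase] at hl'
    rw [hl l hl'.2.1 hl'.1]
    simp [m', hl'.2.1, hl'.1]
  rw [hrest] at hfin
  set S := ∑ l ∈ (Finset.univ.erase i).erase j, n l * m l
  have e1 : m' i = b' - m i := by simp [m']
  have e2 : m' j = b' - m j := by simp [m', hij.symm]
  rw [e1, e2] at hfin
  have f1 : (b' : ℤ) - m i ≤ ((b' - m i : ℕ) : ℤ) := by omega
  have f2 : (b' : ℤ) - m j ≤ ((b' - m j : ℕ) : ℤ) := by omega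
  have g1 := mul_le_mul_of_nonneg_left f1 (Int.natCast_nonneg (n' i))
  have g2 := mul_le_mul_of_nonneg_left f2 (Int.natCast_nonneg (n' j))
  zify at hfin hp hi hj hdeg1 ⊢
  have hp2 : (p : ℤ) = p' + n i + n j - q := by linarith
  have ha : (a : ℤ) = m i + m j + a' - b' := by linarith
  have hni : (n' i : ℤ) = q - n i := by linarith
  have hnj : (n' j : ℤ) = q - n j := by linarith
  rw [hni] at g1 hfin
  rw [hnj] at g2 hfin
  rw [hp2, ha]
  nlinarith

/-- A polynomial function of the coordinates. -/
def PolyFun (f : (Fin 6 → (k × k) × (k × k)) → k) : Prop :=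
  ∃ q : MvPolynomial (Fin 6 × Fin 4) k, ∀ Z, eval (coordsOf k Z) q = f Z

/-- The property `P` holds outside of a hypersurface. -/
def Gen (P : (Fin 6 → (k × k) × (k × k)) → Prop) : Prop :=
  ∃ G : MvPolynomial (Fin 6 × Fin 4) k, G ≠ 0 ∧ ∀ Z, eval (coordsOf k Z) G ≠ 0 → P Z

theorem PolyFun.add {f g : (Fin 6 → (k × k) × (k × k)) → k} (hf : PolyFun f) (hg : PolyFun g) :
    PolyFun (fun Z => f Z + g Z) := by
  obtain ⟨p, hp⟩ := hf
  obtain ⟨q, hq⟩ := hg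
  exact ⟨p + q, fun Z => by rw [map_add, hp, hq]⟩

theorem PolyFun.sub {f g : (Fin 6 → (k × k) × (k × k)) → k} (hf : PolyFun f) (hg : PolyFun g) :
    PolyFun (fun Z => f Z - g Z) := by
  obtain ⟨p, hp⟩ := hf
  obtain ⟨q, hq⟩ := hg
  exact ⟨p - q, fun Z => by rw [map_sub, hp, hq]⟩

theorem PolyFun.mul {f g : (Fin 6 → (k × k) × (k × k)) → k} (hf : PolyFun f) (hg : PolyFun g) :
    PolyFun (fun Z => f Z * g Z) := by
  obtain ⟨p, hp⟩ := hf
  obtain ⟨q, hq⟩ := hg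
  exact ⟨p * q, fun Z => by rw [map_mul, hp, hq]⟩

theorem pf0 (i : Fin 6) : PolyFun (fun Z : Fin 6 → (k × k) × (k × k) => (Z i).1.1) :=
  ⟨X (i, 0), fun Z => by simp [coordsOf]⟩
theorem pf1 (i : Fin 6) : PolyFun (fun Z : Fin 6 → (k × k) × (k × k) => (Z i).1.2) :=
  ⟨X (i, 1), fun Z => by simp [coordsOf]⟩
theorem pf2 (i : Fin 6) : PolyFun (fun Z : Fin 6 → (k × k) × (k × k) => (Z i).2.1) :=
  ⟨X (i, 2), fun Z => by simp [coordsOf]⟩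
theorem pf3 (i : Fin 6) : PolyFun (fun Z : Fin 6 → (k × k) × (k × k) => (Z i).2.2) :=
  ⟨X (i, 3), fun Z => by simp [coordsOf]⟩

theorem pfx (i j : Fin 6) : PolyFun (fun Z : Fin 6 → (k × k) × (k × k) => br (Z i).1 (Z j).1) :=
  ((pf0 i).mul (pf1 j)).sub ((pf1 i).mul (pf0 j))
theorem pfy (i j : Fin 6) : PolyFun (fun Z : Fin 6 → (k × k) × (k × k) => br (Z i).2 (Z j).2) :=
  ((pf2 i).mul (pf3 j)).sub ((pf3 i).mul (pf2 j))

/-- The tuple with given coordinates. -/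
def ofCoords (x : Fin 6 × Fin 4 → k) : Fin 6 → (k × k) × (k × k) :=
  fun i => ((x (i, 0), x (i, 1)), (x (i, 2), x (i, 3)))

set_option linter.unusedSectionVars false in
theorem coordsOf_ofCoords (x : Fin 6 × Fin 4 → k) : coordsOf k (ofCoords x) = x := by
  funext ⟨i, c⟩
  fin_cases c <;> simp [coordsOf, ofCoords]

theorem exists_Z [Infinite k] (G : MvPolynomial (Fin 6 × Fin 4) k) (hG : G ≠ 0) :
    ∃ Z, eval (coordsOf k Z) G ≠ 0 := by
  by_contra! h
  apply hG
  apply MvPolynomial.funext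
  intro x
  rw [map_zero, ← coordsOf_ofCoords x, h]

theorem Gen.and {P Q : (Fin 6 → (k × k) × (k × k)) → Prop} (hP : Gen P) (hQ : Gen Q) :
    Gen (fun Z => P Z ∧ Q Z) := by
  obtain ⟨G, hG, h⟩ := hP
  obtain ⟨G', hG', h'⟩ := hQ
  refine ⟨G * G', mul_ne_zero hG hG', fun Z hZ => ?_⟩
  rw [map_mul] at hZ
  exact ⟨h Z (left_ne_zero_of_mul hZ), h' Z (right_ne_zero_of_mul hZ)⟩

theorem Gen.mono {P Q : (Fin 6 → (k × k) × (k × k)) → Prop} (hP : Gen P) (h : ∀ Z, P Z → Q Z) :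
    Gen Q := by
  obtain ⟨G, hG, h'⟩ := hP
  exact ⟨G, hG, fun Z hZ => h Z (h' Z hZ)⟩

theorem gen_true : Gen (fun _ : Fin 6 → (k × k) × (k × k) => True) :=
  ⟨1, one_ne_zero, fun _ _ => trivial⟩

theorem Gen.all {ι : Type*} (s : Finset ι) (P : ι → (Fin 6 → (k × k) × (k × k)) → Prop)
    (h : ∀ i ∈ s, Gen (P i)) : Gen (fun Z => ∀ i ∈ s, P i Z) := by
  classical
  induction s using Finset.induction_on with
  | empty => exact gen_true.mono (by simp)
  | insert a s _ ih =>
    refine ((h a (by simp)).and (ih fun i hi => h i (by simp [hi]))).mono ?_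
    rintro Z ⟨h1, h2⟩ i hi
    rcases Finset.mem_insert.1 hi with rfl | hi
    · exact h1
    · exact h2 i hi

theorem PolyFun.gen {f : (Fin 6 → (k × k) × (k × k)) → k} (hf : PolyFun f) (Z₀)
    (h : f Z₀ ≠ 0) : Gen (fun Z => f Z ≠ 0) := by
  obtain ⟨q, hq⟩ := hf
  refine ⟨q, ?_, fun Z hZ => by rwa [hq] at hZ⟩
  rintro rfl
  exact h (by rw [← hq, map_zero])

theorem gen_good : Gen (Good (k := k)) := by
  have h : ∀ c ∈ (Finset.univ : Finset (Fin 6 × Fin 6)), Gen (fun Z : Fin 6 → (k × k) × (k × k) =>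
      c.1 ≠ c.2 → br (Z c.1).1 (Z c.2).1 ≠ 0 ∧ br (Z c.1).2 (Z c.2).2 ≠ 0) := by
    rintro ⟨i, j⟩ -
    by_cases hij : i = j
    · exact gen_true.mono (by simp [hij])
    · let Z₀ : Fin 6 → (k × k) × (k × k) := fun l => if l = i then ((1, 0), (1, 0))
        else ((0, 1), (0, 1))
      refine (((pfx i j).gen Z₀ ?_).and ((pfy i j).gen Z₀ ?_)).mono (fun Z h _ => h)
      · simp [Z₀, br, Ne.symm hij]
      · simp [Z₀, br, Ne.symm hij]
  exact (Gen.all _ _ h).mono fun Z hZ i j => hZ (i, j) (Finset.mem_univ _)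

theorem Gen.comp [Infinite k] {P Q : (Fin 6 → (k × k) × (k × k)) → Prop} (hP : Gen P) (hQ : Gen Q)
    (f : (Fin 6 → (k × k) × (k × k)) → (Fin 6 → (k × k) × (k × k)))
    (hf : ∀ c, PolyFun (fun Z => coordsOf k (f Z) c)) (hs : ∀ W, Q W → ∃ Z, f Z = W) :
    Gen (fun Z => P (f Z)) := by
  obtain ⟨G, hG, h⟩ := hP
  obtain ⟨G', hG', h'⟩ := hQ
  choose q hq using hf
  have key : ∀ Z, eval (coordsOf k Z) (bind₁ q G) = eval (coordsOf k (f Z)) G := by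
    intro Z
    change eval₂Hom (RingHom.id k) _ _ = _
    rw [eval₂Hom_bind₁]
    simp only [coe_eval₂Hom]
    have : (fun i => eval₂ (RingHom.id k) (coordsOf k Z) (q i)) = coordsOf k (f Z) := by
      funext c; exact hq c Z
    rw [this]; rfl
  refine ⟨bind₁ q G, ?_, fun Z hZ => h _ (by rwa [key] at hZ)⟩
  intro h0
  obtain ⟨W, hW⟩ := exists_Z (G * G') (mul_ne_zero hG hG')
  rw [map_mul] at hW
  obtain ⟨Z, rfl⟩ := hs W (h' W (right_ne_zero_of_mul hW))
  apply left_ne_zero_of_mul hW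
  rw [← key, h0, map_zero]

theorem T_surj (i j : Fin 6) (hij : i ≠ j) (W : Fin 6 → (k × k) × (k × k)) (hW : Good W) :
    ∃ Z, T i j Z = W := by
  refine ⟨fun l => if l = i then ((W i).1, (W j).2) else if l = j then ((W j).1, (W i).2) else
    ((W l).1, (br (W l).1 (W i).1 * br (W l).1 (W j).1 * br (W i).2 (W j).2 ^ 2)⁻¹ •
      ((br (W l).1 (W i).1 * br (W l).2 (W j).2) • (W i).2 +
      (br (W l).1 (W j).1 * br (W l).2 (W i).2) • (W j).2)), ?_⟩
  funext l
  by_cases hli : l = i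
  · subst hli; simp [T, hij.symm]
  by_cases hlj : l = j
  · subst hlj; simp [T, hli]
  have h1 := (hW l i hli).1
  have h2 := (hW l j hlj).1
  have h3 := (hW i j hij).2
  simp only [T, hli, hlj, hij.symm, if_true, if_false]
  set A := br (W l).1 (W i).1 with hA
  set B := br (W l).1 (W j).1 with hB
  clear_value A B
  refine Prod.ext rfl (Prod.ext ?_ ?_)
  · simp only [br, Prod.fst_add, Prod.snd_add, Prod.smul_fst, Prod.smul_snd, smul_eq_mul] at h3 ⊢
    field_simp
    ring
  · simp only [br, Prod.fst_add, Prod.snd_add, Prod.smul_fst, Prod.smul_snd, smul_eq_mul] at h3 ⊢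
    field_simp
    ring

theorem T_poly (i j : Fin 6) (c) : PolyFun (fun Z => coordsOf k (T i j Z) c) := by
  obtain ⟨l, c⟩ := c
  have hA := (pfx (k := k) l i).mul (pfy l j)
  have hB := (pfx (k := k) l j).mul (pfy l i)
  by_cases hli : l = i
  · fin_cases c
    · simpa [coordsOf, T, hli] using pf0 i
    · simpa [coordsOf, T, hli] using pf1 i
    · simpa [coordsOf, T, hli] using pf2 j
    · simpa [coordsOf, T, hli] using pf3 j
  by_cases hlj : l = j
  · fin_cases c
    · simpa [coordsOf, T, hli, hlj, hlj ▸ hli] using pf0 j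
    · simpa [coordsOf, T, hli, hlj, hlj ▸ hli] using pf1 j
    · simpa [coordsOf, T, hli, hlj, hlj ▸ hli] using pf2 i
    · simpa [coordsOf, T, hli, hlj, hlj ▸ hli] using pf3 i
  · fin_cases c
    · simpa [coordsOf, T, hli, hlj] using pf0 l
    · simpa [coordsOf, T, hli, hlj] using pf1 l
    · simpa [coordsOf, T, hli, hlj] using (hA.mul (pf2 i)).add (hB.mul (pf2 j))
    · simpa [coordsOf, T, hli, hlj] using (hA.mul (pf3 i)).add (hB.mul (pf3 j))

theorem genT [Infinite k] (i j : Fin 6) (hij : i ≠ j) (p q p' : ℕ) (n n' : Fin 6 → ℕ)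
    (h : Gen (fun Z : Fin 6 → (k × k) × (k × k) => Nef Z p' q n'))
    (hp : p' + n i + n j = p + q) (hi : n' i + n i = q)
    (hj : n' j + n j = q) (hl : ∀ l, l ≠ i → l ≠ j → n' l = n l) :
    Gen (fun Z : Fin 6 → (k × k) × (k × k) => Nef Z p q n) :=
  ((h.comp gen_good (T i j) (T_poly i j) (T_surj i j hij)).and gen_good).mono
    fun Z hZ => step i j hij Z hZ.2 p q p' n n' hp hi hj hl hZ.1

/-- Swapping the two factors. -/
def swapHom : MvPolynomial (Fin 4) k →+* MvPolynomial (Fin 4) k :=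
  eval₂Hom C ![X 2, X 3, X 0, X 1]

theorem swap_swap (F : MvPolynomial (Fin 4) k) : swapHom (swapHom F) = F := by
  have : (swapHom (k := k)).comp swapHom = RingHom.id _ := by
    apply MvPolynomial.ringHom_ext
    · intro r; simp [swapHom]
    · intro i
      fin_cases i <;> simp [swapHom]
  exact congrArg (fun f => f F) this

theorem nef_swap (Z : Fin 6 → (k × k) × (k × k)) (p q : ℕ) (n : Fin 6 → ℕ)
    (h : Nef (fun l => ((Z l).2, (Z l).1)) q p n) : Nef Z p q n := by
  intro F a b m hF0 hF hm
  rw [add_comm]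
  refine h (swapHom F) b a m ?_ ?_ ?_
  · intro h0
    apply hF0
    rw [← swap_swap F, h0, map_zero]
  · have := hom_map swapHom (0, 1) (1, 0) a b (by simp [swapHom])
      (by simpa [swapHom, w4] using isWeightedHomogeneous_X k w4 2)
      (by simpa [swapHom, w4] using isWeightedHomogeneous_X k w4 3)
      (by simpa [swapHom, w4] using isWeightedHomogeneous_X k w4 0)
      (by simpa [swapHom, w4] using isWeightedHomogeneous_X k w4 1) F hF
    convert this using 1
    simp
  · intro i
    refine map_pow_mem _ {lx (Z i).1, ly (Z i).2} _ ?_ F _ (hm i)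
    rintro _ (rfl | rfl)
    · have : swapHom (lx (Z i).1) = ly (Z i).1 := by simp [swapHom, lx, ly]
      rw [this]
      exact ly_mem ((Z i).2, (Z i).1)
    · have : swapHom (ly (Z i).2) = lx (Z i).2 := by simp [swapHom, lx, ly]
      rw [this]
      exact lx_mem ((Z i).2, (Z i).1)

theorem genS [Infinite k] (p q : ℕ) (n : Fin 6 → ℕ)
    (h : Gen (fun Z : Fin 6 → (k × k) × (k × k) => Nef Z q p n)) :
    Gen (fun Z : Fin 6 → (k × k) × (k × k) => Nef Z p q n) := by
  refine (h.comp gen_true (fun Z l => ((Z l).2, (Z l).1)) ?_ ?_).mono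
    fun Z hZ => nef_swap Z p q n hZ
  · rintro ⟨l, c⟩
    fin_cases c
    · simpa [coordsOf] using pf2 l
    · simpa [coordsOf] using pf3 l
    · simpa [coordsOf] using pf0 l
    · simpa [coordsOf] using pf1 l
  · intro W _
    exact ⟨fun l => ((W l).2, (W l).1), rfl⟩

theorem gen_nef [Infinite k] :
    Gen (fun Z : Fin 6 → (k × k) × (k × k) => Nef Z 7 7 (fun _ => 4)) := by
  have h0 : Gen (fun Z : Fin 6 → (k × k) × (k × k) => Nef Z 1 1 ![0, 0, 0, 0, 0, 0]) := by
    refine gen_true.mono fun Z _ F a b m _ _ _ => ?_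
    simp [Fin.sum_univ_six]
  have h1 := genS _ _ _ (genT 4 5 (by decide) 2 1 1 ![0, 0, 0, 0, 1, 1] _ h0
    (by decide) (by decide) (by decide) (by decide))
  have h2 := genS _ _ _ (genT 2 3 (by decide) 3 2 1 ![0, 0, 2, 2, 1, 1] _ h1
    (by decide) (by decide) (by decide) (by decide))
  have h3 := genS _ _ _ (genT 0 1 (by decide) 5 3 2 ![3, 3, 2, 2, 1, 1] _ h2
    (by decide) (by decide) (by decide) (by decide))
  have h4 := genS _ _ _ (genT 4 5 (by decide) 6 5 3 ![3, 3, 2, 2, 4, 4] _ h3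
    (by decide) (by decide) (by decide) (by decide))
  have h5 := genS _ _ _ (genT 2 3 (by decide) 7 6 5 ![3, 3, 4, 4, 4, 4] _ h4
    (by decide) (by decide) (by decide) (by decide))
  exact genT 0 1 (by decide) 7 7 6 (fun _ => 4) _ h5
    (by decide) (by decide) (by decide) (by decide)

theorem mem_of_evp (p : (k × k) × (k × k)) (hp : IsPtRep k p) (F : MvPolynomial (Fin 4) k) (a b : ℕ)
    (hF : F.IsWeightedHomogeneous w4 (a, b)) (h : evp p F = 0) : F ∈ pointIdeal k p := by
  obtain ⟨u, v⟩ := p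
  obtain ⟨hu, hv⟩ := hp
  obtain ⟨s, hs⟩ := exists_dual u hu
  obtain ⟨t, ht⟩ := exists_dual v hv
  simp only [br] at hs ht
  have hsC : (C u.1 * C s.2 - C u.2 * C s.1 : MvPolynomial (Fin 4) k) = 1 := by
    rw [← C_mul, ← C_mul, ← C_sub, hs, C_1]
  have htC : (C v.1 * C t.2 - C v.2 * C t.1 : MvPolynomial (Fin 4) k) = 1 := by
    rw [← C_mul, ← C_mul, ← C_sub, ht, C_1]
  let f : MvPolynomial (Fin 4) k →+* MvPolynomial (Fin 4) k :=
    eval₂Hom C ![lx s * C u.1, lx s * C u.2, ly t * C v.1, ly t * C v.2]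
  have h1 := hom_scale f (C.comp (evp (u, v))) (lx s) (ly t) a b (by simp [f, evp])
    (by simp [f, evp]) (by simp [f, evp]) (by simp [f, evp]) (by simp [f, evp]) F hF
  rw [RingHom.comp_apply, h, map_zero, mul_zero] at h1
  have h2 : (Ideal.Quotient.mk (pointIdeal k (u, v))).comp f = Ideal.Quotient.mk _ := by
    have hx := lx_mem (k := k) (u, v)
    have hy := ly_mem (k := k) (u, v)
    apply MvPolynomial.ringHom_ext
    · intro r; simp [f]
    · intro i
      rw [RingHom.comp_apply, Ideal.Quotient.eq]
      fin_cases i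
      · have : f (X 0) - X 0 = C s.1 * lx u := by
          simp [f, lx]; linear_combination (X 0) * hsC
        exact this ▸ Ideal.mul_mem_left _ _ hx
      · have : f (X 1) - X 1 = C s.2 * lx u := by
          simp [f, lx]; linear_combination (X 1) * hsC
        exact this ▸ Ideal.mul_mem_left _ _ hx
      · have : f (X 2) - X 2 = C t.1 * ly v := by
          simp [f, ly]; linear_combination (X 2) * htC
        exact this ▸ Ideal.mul_mem_left _ _ hy
      · have : f (X 3) - X 3 = C t.2 * ly v := by
          simp [f, ly]; linear_combination (X 3) * htC
        exact this ▸ Ideal.mul_mem_left _ _ hy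
  have h3 := congrArg (fun g => g F) h2
  simp only [RingHom.comp_apply, h1, map_zero] at h3
  exact Ideal.Quotient.eq_zero_iff_mem.1 h3.symm

/-- exponents of the monomials of bidegree `(2,2)` which are singular at a point -/
def E6 : Fin 6 → Fin 4 → ℕ := ![![2, 0, 0, 2], ![2, 0, 1, 1], ![2, 0, 2, 0], ![1, 1, 1, 1],
  ![1, 1, 2, 0], ![0, 2, 2, 0]]

theorem E6_inj : Function.Injective E6 := by decide

theorem exists_curve (Z : Fin 6 → (k × k) × (k × k)) (hZ : Good Z) (i : Fin 6) :
    ∃ F : MvPolynomial (Fin 4) k, F ≠ 0 ∧ F.IsWeightedHomogeneous w4 (2, 2) ∧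
      ∀ j, F ∈ pointIdeal k (Z j) ^ (if i = j then 2 else 1) := by
  have hE : ∀ l, 2 ≤ E6 l 0 + E6 l 2 := by decide
  set u := (Z i).1 with hu
  set v := (Z i).2 with hv
  obtain ⟨s, hs⟩ := exists_dual u (hZ.rep i).1
  obtain ⟨t, ht⟩ := exists_dual v (hZ.rep i).2
  simp only [br] at hs ht
  have hsC : (C u.1 * C s.2 - C u.2 * C s.1 : MvPolynomial (Fin 4) k) = 1 := by
    rw [← C_mul, ← C_mul, ← C_sub, hs, C_1]
  have htC : (C v.1 * C t.2 - C v.2 * C t.1 : MvPolynomial (Fin 4) k) = 1 := by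
    rw [← C_mul, ← C_mul, ← C_sub, ht, C_1]
  let M : Fin 6 → MvPolynomial (Fin 4) k := fun l =>
    lx u ^ E6 l 0 * lx s ^ E6 l 1 * ly v ^ E6 l 2 * ly t ^ E6 l 3
  let A : Matrix (Fin 5) (Fin 6) k := fun j l => evp (Z (i.succAbove j)) (M l)
  have hker : LinearMap.ker A.mulVecLin ≠ ⊥ := LinearMap.ker_ne_bot_of_finrank_lt (by simp)
  obtain ⟨c, hc, hc0⟩ := Submodule.exists_mem_ne_zero_of_ne_bot hker
  have hMhom : ∀ l, (M l).IsWeightedHomogeneous w4 (2, 2) := by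
    intro l
    have := ((((lx_hom u).pow (E6 l 0)).mul ((lx_hom s).pow (E6 l 1))).mul
      ((ly_hom v).pow (E6 l 2))).mul ((ly_hom t).pow (E6 l 3))
    convert this using 1
    clear this; revert l; decide
  have hFhom : (∑ l, C (c l) * M l).IsWeightedHomogeneous w4 (2, 2) :=
    IsWeightedHomogeneous.sum _ _ _ fun l _ => (hMhom l).C_mul _
  refine ⟨∑ l, C (c l) * M l, ?_, hFhom, ?_⟩
  · intro h0
    apply hc0
    let τ : MvPolynomial (Fin 4) k →+* MvPolynomial (Fin 4) k :=
      eval₂Hom C ![C u.1 * X 1 - C s.1 * X 0, C u.2 * X 1 - C s.2 * X 0,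
        C v.1 * X 3 - C t.1 * X 2, C v.2 * X 3 - C t.2 * X 2]
    have t0 : τ (lx u) = X 0 := by simp [τ, lx]; linear_combination (X 0) * hsC
    have t1 : τ (lx s) = X 1 := by simp [τ, lx]; linear_combination (X 1) * hsC
    have t2 : τ (ly v) = X 2 := by simp [τ, ly]; linear_combination (X 2) * htC
    have t3 : τ (ly t) = X 3 := by simp [τ, ly]; linear_combination (X 3) * htC
    have h1 := congrArg τ h0
    have h2 : ∀ l, τ (C (c l) * M l) = monomial (Finsupp.equivFunOnFinite.symm (E6 l)) (c l) := by
      intro l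
      rw [monomial_eq, Finsupp.prod_fintype _ _ (by simp), Fin.prod_univ_four]
      simp only [M, map_mul, map_pow, t0, t1, t2, t3]
      simp [τ]
    rw [map_sum, map_zero] at h1
    simp only [h2] at h1
    funext l
    have h3 := congrArg (coeff (Finsupp.equivFunOnFinite.symm (E6 l))) h1
    simpa [coeff_sum, coeff_monomial, E6_inj.eq_iff] using h3
  · intro j
    by_cases hij : i = j
    · subst hij
      rw [if_pos rfl]
      refine Ideal.sum_mem _ fun l _ => Ideal.mul_mem_left _ _ ?_
      have h1 : lx u ^ E6 l 0 * ly v ^ E6 l 2 ∈ pointIdeal k (Z i) ^ (E6 l 0 + E6 l 2) := by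
        rw [pow_add]
        exact Ideal.mul_mem_mul (Ideal.pow_mem_pow (lx_mem (Z i)) _)
          (Ideal.pow_mem_pow (ly_mem (Z i)) _)
      have h2 := hE l
      have h3 := Ideal.mul_mem_right (lx s ^ E6 l 1 * ly t ^ E6 l 3) _
        (Ideal.pow_le_pow_right h2 h1)
      convert h3 using 1
      simp only [M]; ring
    · rw [if_neg hij, pow_one]
      refine mem_of_evp _ (hZ.rep j) _ 2 2 hFhom ?_
      obtain ⟨j', rfl⟩ := Fin.exists_succAbove_eq (Ne.symm hij)
      have := congrFun (LinearMap.mem_ker.1 hc) j'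
      rw [Matrix.mulVecLin_apply] at this
      change ∑ l, evp (Z (i.succAbove j')) (M l) * c l = 0 at this
      rw [map_sum, ← this]
      refine Finset.sum_congr rfl fun l _ => ?_
      rw [map_mul, mul_comm]
      simp [evp]

theorem exists_D (Z : Fin 6 → (k × k) × (k × k)) (hZ : Good Z) :
    ∃ F : MvPolynomial (Fin 4) k, F ≠ 0 ∧ F.IsWeightedHomogeneous w4 (12, 12) ∧
      ∀ j, F ∈ pointIdeal k (Z j) ^ 7 := by
  choose F h0 hh hm using exists_curve Z hZ
  refine ⟨∏ i, F i, Finset.prod_ne_zero_iff.2 fun i _ => h0 i, ?_, fun j => ?_⟩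
  · have := IsWeightedHomogeneous.prod Finset.univ F (fun _ => (2, 2)) (w := w4) (fun i _ => hh i)
    simpa using this
  · have := Ideal.prod_mem_prod (ι := Fin 6) (s := Finset.univ)
      (I := fun i => pointIdeal k (Z j) ^ (if i = j then 2 else 1)) (x := F) (fun i _ => hm i j)
    rw [Finset.prod_pow_eq_pow_sum] at this
    convert this using 2
    clear this; revert j; decide

theorem limit_of_good (Z : Fin 6 → (k × k) × (k × k)) (hZ : Good Z)
    (hN : Nef Z 7 7 (fun _ => 4)) :
    Filter.Tendsto (fun m : ℕ => (alpha k (symbolicPower k Z m) : ℝ) / m)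
      Filter.atTop (nhds (24 / 7 : ℝ)) := by
  obtain ⟨D, hD0, hDh, hDm⟩ := exists_D Z hZ
  have hmem : ∀ m : ℕ, 24 * ((m + 6) / 7) ∈ {t | ∃ F ∈ symbolicPower k Z m, F ≠ 0 ∧
      ∃ d : ℕ × ℕ, d.1 + d.2 = t ∧ F.IsWeightedHomogeneous w4 d} := by
    intro m
    refine ⟨D ^ ((m + 6) / 7), ?_, pow_ne_zero _ hD0, _, ?_, hDh.pow _⟩
    · simp only [symbolicPower, Ideal.mem_iInf]
      intro i
      have := Ideal.pow_mem_pow (hDm i) ((m + 6) / 7)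
      rw [← pow_mul] at this
      exact Ideal.pow_le_pow_right (by omega) this
    · simp; ring
  have hupper : ∀ m : ℕ, alpha k (symbolicPower k Z m) ≤ 24 * ((m + 6) / 7) := fun m =>
    Nat.sInf_le (hmem m)
  have hlower : ∀ m : ℕ, 24 * m ≤ 7 * alpha k (symbolicPower k Z m) := by
    intro m
    obtain ⟨F, hF, hF0, ⟨a, b⟩, hd, hh⟩ := Nat.sInf_mem ⟨_, hmem m⟩
    have hF' : ∀ i, F ∈ pointIdeal k (Z i) ^ m := by
      simpa only [symbolicPower, Ideal.mem_iInf] using hF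
    have := hN F a b (fun _ => m) hF0 hh hF'
    have hd' : a + b = alpha k (symbolicPower k Z m) := hd
    rw [← hd']
    simp at this
    omega
  refine tendsto_of_tendsto_of_tendsto_of_le_of_le' (g := fun _ => (24 / 7 : ℝ))
    (h := fun m : ℕ => (24 / 7 : ℝ) + (144 / 7) / m) tendsto_const_nhds ?_ ?_ ?_
  · simpa using tendsto_const_nhds.add (tendsto_const_div_atTop_nhds_zero_nat (144 / 7 : ℝ))
  · filter_upwards [Filter.eventually_gt_atTop 0] with m hm
    have hm' : (0 : ℝ) < m := by exact_mod_cast hm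
    rw [le_div_iff₀ hm']
    have : (24 * m : ℝ) ≤ 7 * alpha k (symbolicPower k Z m) := by exact_mod_cast hlower m
    linarith
  · filter_upwards [Filter.eventually_gt_atTop 0] with m hm
    have hm' : (0 : ℝ) < m := by exact_mod_cast hm
    rw [div_le_iff₀ hm', add_mul, div_mul_cancel₀ _ hm'.ne']
    have h1 : 7 * alpha k (symbolicPower k Z m) ≤ 24 * (m + 6) := by
      have := hupper m
      omega
    have : (7 * alpha k (symbolicPower k Z m) : ℝ) ≤ 24 * (m + 6) := by exact_mod_cast h1
    linarith

theorem pointIdeal_smul (s t : k) (hs : s ≠ 0) (ht : t ≠ 0) (u v : k × k) :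
    pointIdeal k (s • u, t • v) = pointIdeal k (u, v) := by
  have hx : lx (s • u) = C s * lx u := by simp [lx]; ring
  have hy : ly (t • v) = C t * ly v := by simp [ly]; ring
  apply le_antisymm
  · rw [pointIdeal_eq, Ideal.span_le]
    rintro _ (rfl | rfl)
    · exact hx ▸ Ideal.mul_mem_left _ _ (lx_mem (u, v))
    · exact hy ▸ Ideal.mul_mem_left _ _ (ly_mem (u, v))
  · rw [pointIdeal_eq, Ideal.span_le]
    rintro _ (rfl | rfl)
    · exact mul_C_mem hs (hx ▸ lx_mem (s • u, t • v))
    · exact mul_C_mem ht (hy ▸ ly_mem (s • u, t • v))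

/-- The exponent vector associated with a multidegree. -/
def expo : (Fin 6 → ℕ × ℕ) →+ (Fin 6 × Fin 2 →₀ ℕ) where
  toFun d := Finsupp.equivFunOnFinite.symm fun p => ![(d p.1).1, (d p.1).2] p.2
  map_zero' := by ext ⟨i, c⟩; fin_cases c <;> simp
  map_add' d e := by ext ⟨i, c⟩; fin_cases c <;> simp

theorem expo_inj : Function.Injective expo := by
  intro d e h
  funext i
  have h0 := DFunLike.congr_fun h (i, 0)
  have h1 := DFunLike.congr_fun h (i, 1)
  simp [expo] at h0 h1
  exact Prod.ext h0 h1

/-- scaling substitution -/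
def scHom (x : Fin 6 × Fin 4 → k) :
    MvPolynomial (Fin 6 × Fin 4) k →+* MvPolynomial (Fin 6 × Fin 2) k :=
  eval₂Hom C fun p => C (x p) * X (p.1, ![0, 0, 1, 1] p.2)

theorem scHom_monomial (x : Fin 6 × Fin 4 → k) (e : Fin 6 × Fin 4 →₀ ℕ) (r : k) :
    scHom x (monomial e r) = monomial (expo (Finsupp.weight (wProd 6) e)) (eval x (monomial e r)) := by
  have h1 : ∀ e : Fin 6 × Fin 4 →₀ ℕ, scHom x (monomial e 1) =
      monomial (expo (Finsupp.weight (wProd 6) e)) (eval x (monomial e 1)) := by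
    intro e
    induction e using Finsupp.induction_linear with
    | zero => simp [scHom]
    | add f g hf hg =>
      have : (monomial (f + g) (1 : k)) = monomial f 1 * monomial g 1 := by simp [monomial_mul]
      rw [this, map_mul, hf, hg, map_mul, map_add, map_add, monomial_mul]
    | single p n =>
      obtain ⟨i, c⟩ := p
      have : (monomial (Finsupp.single (i, c) n) (1 : k)) = X (i, c) ^ n := by
        rw [X_pow_eq_monomial]
      rw [this]
      have h2 : expo (Finsupp.weight (wProd 6) (Finsupp.single (i, c) n)) =
          n • Finsupp.single (i, ![0, 0, 1, 1] c) 1 := by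
        rw [Finsupp.weight_single, map_nsmul]
        congr 1
        ext ⟨i', c'⟩
        simp only [expo, wProd, w4, AddMonoidHom.coe_mk, ZeroHom.coe_mk,
          Finsupp.equivFunOnFinite_symm_apply_apply, Finsupp.single_apply, Prod.mk.injEq]
        by_cases hi : i = i'
        · subst hi
          fin_cases c <;> fin_cases c' <;> simp
        · fin_cases c <;> fin_cases c' <;> simp [hi, Pi.single_apply, Ne.symm hi, Ne.symm (Ne.intro hi)]
      rw [h2]
      simp only [scHom, map_pow, coe_eval₂Hom, eval₂_X, eval_X, mul_pow]
      rw [X, monomial_pow, ← map_pow, C_mul_monomial]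
      simp
  have h2 : monomial e r = C r * monomial e (1 : k) := by simp [C_mul_monomial]
  rw [h2, map_mul, h1, map_mul, eval_C]
  simp [scHom, C_mul_monomial]

theorem scHom_coeff (x : Fin 6 × Fin 4 → k) (G : MvPolynomial (Fin 6 × Fin 4) k)
    (d : Fin 6 → ℕ × ℕ) :
    coeff (expo d) (scHom x G) = eval x (weightedHomogeneousComponent (wProd 6) d G) := by
  classical
  conv_lhs => rw [G.as_sum]
  rw [weightedHomogeneousComponent_apply, map_sum, map_sum, coeff_sum, Finset.sum_filter]
  refine Finset.sum_congr rfl fun e _ => ?_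
  rw [scHom_monomial, coeff_monomial]
  simp only [expo_inj.eq_iff]

theorem eval_scHom (y : Fin 6 × Fin 2 → k) (Z : Fin 6 → (k × k) × (k × k))
    (G : MvPolynomial (Fin 6 × Fin 4) k) : eval y (scHom (coordsOf k Z) G) =
      eval (coordsOf k fun i => (y (i, 0) • (Z i).1, y (i, 1) • (Z i).2)) G := by
  have : (eval y).comp (scHom (coordsOf k Z)) =
      eval (coordsOf k fun i => (y (i, 0) • (Z i).1, y (i, 1) • (Z i).2)) := by
    apply MvPolynomial.ringHom_ext
    · intro r; simp [scHom]
    · rintro ⟨i, c⟩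
      fin_cases c <;> simp [scHom, coordsOf, mul_comm]
  exact congrArg (fun f => f G) this

theorem general_of_gen [Infinite k] (P : (Fin 6 → (k × k) × (k × k)) → Prop) (hP : Gen P)
    (hinv : ∀ Z (y : Fin 6 × Fin 2 → k), (∀ c, y c ≠ 0) →
      P (fun i => (y (i, 0) • (Z i).1, y (i, 1) • (Z i).2)) → P Z) :
    GeneralPosition k 6 P := by
  classical
  obtain ⟨G, hG, h⟩ := hP
  obtain ⟨e, he⟩ := ne_zero_iff.1 hG
  set d := Finsupp.weight (wProd 6) e with hd
  have hGd : weightedHomogeneousComponent (wProd 6) d G ≠ 0 := by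
    intro h0
    have := coeff_weightedHomogeneousComponent (w := wProd 6) d G e
    rw [h0, if_pos rfl] at this
    exact he (by simpa using this.symm)
  refine ⟨weightedHomogeneousComponent (wProd 6) d G, d,
    weightedHomogeneousComponent_isWeightedHomogeneous _ _, ?_, ?_⟩
  · obtain ⟨Z, hZ⟩ := exists_Z (weightedHomogeneousComponent (wProd 6) d G * ∏ c, X c)
      (mul_ne_zero hGd (Finset.prod_ne_zero_iff.2 fun c _ => X_ne_zero c))
    rw [map_mul, map_prod] at hZ
    have h2 := Finset.prod_ne_zero_iff.1 (right_ne_zero_of_mul hZ)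
    refine ⟨Z, fun i => ⟨?_, ?_⟩, left_ne_zero_of_mul hZ⟩
    · intro h0
      apply h2 (i, 0) (Finset.mem_univ _)
      simp [coordsOf, h0]
    · intro h0
      apply h2 (i, 2) (Finset.mem_univ _)
      simp [coordsOf, h0]
  · intro Z _ _ hZ
    rw [← scHom_coeff] at hZ
    have hH : scHom (coordsOf k Z) G ≠ 0 := by
      intro h0
      rw [h0] at hZ
      simp at hZ
    have hex : ∃ y : Fin 6 × Fin 2 → k,
        eval y (scHom (coordsOf k Z) G * ∏ c, X c) ≠ 0 := by
      have hne : scHom (coordsOf k Z) G * ∏ c : Fin 6 × Fin 2, X c ≠ 0 :=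
        mul_ne_zero hH (Finset.prod_ne_zero_iff.2 fun c _ => X_ne_zero c)
      by_contra! hcon
      exact hne (MvPolynomial.funext fun y => by rw [hcon, map_zero])
    obtain ⟨y, hy⟩ := hex
    rw [map_mul, map_prod, eval_scHom] at hy
    refine hinv Z y (fun c => ?_) (h _ (left_ne_zero_of_mul hy))
    simpa using Finset.prod_ne_zero_iff.1 (right_ne_zero_of_mul hy) c (Finset.mem_univ _)

end helpers

end Gam

/-- For `6` general points of `P^1 × P^1`, `γ(I) = 24/7`. -/
theorem gamma_general_points_6 {k : Type*} [Field k] [IsAlgClosed k] :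
    GeneralPosition k 6 (fun Z =>
      Filter.Tendsto
        (fun m : ℕ => (alpha k (symbolicPower k Z m) : ℝ) / m)
        Filter.atTop (nhds (24 / 7 : ℝ))) := by
  have : Infinite k := inferInstance
  refine Gam.general_of_gen _ ((Gam.gen_good.and Gam.gen_nef).mono
    fun Z hZ => Gam.limit_of_good Z hZ.1 hZ.2) ?_
  intro Z y hy h
  have e : ∀ m, symbolicPower k (fun i => (y (i, 0) • (Z i).1, y (i, 1) • (Z i).2)) m =
      symbolicPower k Z m := by
    intro m
    simp only [symbolicPower, Gam.pointIdeal_smul _ _ (hy _) (hy _)]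
  simpa only [e] using h
end
end
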